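/- arXiv:2002.10035 — 3 statements merged into one kernel-verified Lean document; each statement's English description precedes it below -/
import Mathlib

section
/- There exists a set of 1259180741 four-dimensional subspaces of F_2^{14} whose pairwise subspace distance is at least 4; that is, A_2(14,4,4) ≥ 1259180741. -/
/-- The subspace distance `d_S(U,W) = 2·dim(U+W) − dim U − dim W` between two
subspaces of an `F`-vector space. -/
noncomputable def subspaceDist {F V : Type*} [Field F] [AddCommGroup V] [Module F V]
    (U W : Submodule F V) : ℕ :=
  2 * Module.finrank F ↥(U ⊔ W) - Module.finrank F ↥U - Module.finrank F ↥W

/-- The row space `im(A)` of a matrix `A`, i.e. the span of its rows. -/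
def rowSpace {F : Type*} [Field F] {k n : ℕ} (A : Matrix (Fin k) (Fin n) F) :
    Submodule F (Fin n → F) :=
  Submodule.span F (Set.range fun i : Fin k => A i)

/-- Horizontal concatenation `(U | M)` of two matrices with the same number of rows. -/
def hcat {F : Type*} [Field F] {k n1 n2 : ℕ} (U : Matrix (Fin k) (Fin n1) F)
    (M : Matrix (Fin k) (Fin n2) F) : Matrix (Fin k) (Fin (n1 + n2)) F :=
  Matrix.of fun i => Fin.append (U i) (M i)

/-- The projection of `F^(n1+n2)` onto the first `n1` coordinates. -/
noncomputable def proj1 (F : Type*) [Field F] (n1 n2 : ℕ) :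
    (Fin (n1 + n2) → F) →ₗ[F] (Fin n1 → F) :=
  LinearMap.funLeft F F (Fin.castAdd n2)

section LinearAlgebra

variable {F V E K : Type*} [Field F] [AddCommGroup V] [Module F V] [AddCommGroup E] [Module F E]
  [AddCommGroup K] [Module F K]

/-- A family of `k`-dimensional subspaces whose members pairwise meet in dimension at most `r`. -/
def IsCode {I : Type*} (k r : ℕ) (Φ : I → Submodule F V) : Prop :=
  (∀ i, Module.finrank F (Φ i) = k) ∧ ∀ i j, i ≠ j → Module.finrank F ↥(Φ i ⊓ Φ j) ≤ r

/-- The subspace `{(v, w) | v ∈ N, w - f v ∈ P}` of `V × E`. -/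
def graphAdd (N : Submodule F V) (f : V →ₗ[F] E) (P : Submodule F E) : Submodule F (V × E) :=
  N.comap (LinearMap.fst F V E) ⊓ P.comap (LinearMap.snd F V E - f ∘ₗ LinearMap.fst F V E)

theorem mem_graphAdd {N : Submodule F V} {f : V →ₗ[F] E} {P : Submodule F E} {x : V × E} :
    x ∈ graphAdd N f P ↔ x.1 ∈ N ∧ x.2 - f x.1 ∈ P := by
  simp [graphAdd]

theorem map_fst_graphAdd (N : Submodule F V) (f : V →ₗ[F] E) (P : Submodule F E) :
    (graphAdd N f P).map (LinearMap.fst F V E) = N := by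
  ext v
  simp only [Submodule.mem_map, mem_graphAdd, LinearMap.fst_apply]
  constructor
  · rintro ⟨x, hx, rfl⟩
    exact hx.1
  · intro hv
    exact ⟨(v, f v), by simp [hv], rfl⟩

theorem comap_inr_graphAdd (N : Submodule F V) (f : V →ₗ[F] E) (P : Submodule F E) :
    (graphAdd N f P).comap (LinearMap.inr F V E) = P := by
  ext w
  simp [mem_graphAdd]

theorem finrank_eq_map_fst_add_comap_inr [FiniteDimensional F V] [FiniteDimensional F E]
    (X : Submodule F (V × E)) :
    Module.finrank F X = Module.finrank F (X.map (LinearMap.fst F V E)) +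
      Module.finrank F (X.comap (LinearMap.inr F V E)) := by
  have h := LinearMap.finrank_range_add_finrank_ker ((LinearMap.fst F V E).domRestrict X)
  rw [LinearMap.range_domRestrict] at h
  rw [← h]
  congr 1
  rw [(Submodule.equivMapOfInjective X.subtype X.subtype_injective _).finrank_eq,
    (Submodule.equivMapOfInjective (LinearMap.inr F V E) LinearMap.inr_injective _).finrank_eq]
  suffices h' : (LinearMap.ker ((LinearMap.fst F V E).domRestrict X)).map X.subtype =
      (X.comap (LinearMap.inr F V E)).map (LinearMap.inr F V E) by rw [h']
  ext ⟨v, w⟩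
  simp only [Submodule.mem_map]
  constructor
  · rintro ⟨⟨⟨v', w'⟩, hx⟩, h1, h2⟩
    simp only [LinearMap.mem_ker, LinearMap.domRestrict_apply, LinearMap.fst_apply] at h1
    simp only [Submodule.subtype_apply, Prod.mk.injEq] at h2
    obtain ⟨rfl, rfl⟩ := h2
    subst h1
    exact ⟨w', by simpa using hx, rfl⟩
  · rintro ⟨w', hw, h2⟩
    exact ⟨⟨(0, w'), by simpa using hw⟩, by simp, by simpa using h2⟩

theorem finrank_graphAdd [FiniteDimensional F V] [FiniteDimensional F E]
    (N : Submodule F V) (f : V →ₗ[F] E) (P : Submodule F E) :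
    Module.finrank F (graphAdd N f P) = Module.finrank F N + Module.finrank F P := by
  rw [finrank_eq_map_fst_add_comap_inr, map_fst_graphAdd, comap_inr_graphAdd]

theorem finrank_graphAdd_inf_le [FiniteDimensional F V] [FiniteDimensional F E]
    (N N' : Submodule F V) (f f' : V →ₗ[F] E) (P P' : Submodule F E) :
    Module.finrank F ↥(graphAdd N f P ⊓ graphAdd N' f' P') ≤
      Module.finrank F ↥(N ⊓ N') + Module.finrank F ↥(P ⊓ P') := by
  rw [finrank_eq_map_fst_add_comap_inr, Submodule.comap_inf, comap_inr_graphAdd,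
    comap_inr_graphAdd]
  gcongr
  refine Submodule.finrank_mono ((Submodule.map_inf_le _).trans_eq ?_)
  rw [map_fst_graphAdd, map_fst_graphAdd]

theorem finrank_graphAdd_inf_le_of_same [FiniteDimensional F V] [FiniteDimensional F E]
    (N : Submodule F V) (f f' : V →ₗ[F] E) (P : Submodule F E) :
    Module.finrank F ↥(graphAdd N f P ⊓ graphAdd N f' P) ≤
      Module.finrank F ↥(N ⊓ P.comap (f - f')) + Module.finrank F P := by
  rw [finrank_eq_map_fst_add_comap_inr, Submodule.comap_inf, comap_inr_graphAdd,
    comap_inr_graphAdd, inf_idem]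
  gcongr
  refine Submodule.finrank_mono ?_
  rintro v ⟨x, ⟨h1, h2⟩, rfl⟩
  rw [SetLike.mem_coe, mem_graphAdd] at h1 h2
  refine ⟨h1.1, ?_⟩
  have := P.sub_mem h2.2 h1.2
  simpa using this

theorem exists_linearMap_inf_ker_eq_bot [FiniteDimensional F V] [FiniteDimensional F K]
    (N : Submodule F V) (h : Module.finrank F N ≤ Module.finrank F K) :
    ∃ f : V →ₗ[F] K, N ⊓ LinearMap.ker f = ⊥ := by
  obtain ⟨g, hg⟩ := finrank_le_iff_exists_linearMap.mp h
  obtain ⟨f, hf⟩ := LinearMap.exists_extend g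
  refine ⟨f, (Submodule.eq_bot_iff _).2 ?_⟩
  rintro v ⟨hv, hv'⟩
  have : g ⟨v, hv⟩ = 0 := by rw [← hf]; simpa using hv'
  simpa using hg (this.trans (map_zero g).symm)

theorem exists_linearMap_comap_eq_bot [FiniteDimensional F E] [FiniteDimensional F K]
    (P : Submodule F E) (h : Module.finrank F K + Module.finrank F P ≤ Module.finrank F E) :
    ∃ f : K →ₗ[F] E, P.comap f = ⊥ := by
  obtain ⟨Q, hQ⟩ := P.exists_isCompl
  have := Submodule.finrank_add_eq_of_isCompl hQ
  obtain ⟨g, hg⟩ := finrank_le_iff_exists_linearMap.mp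
    (show Module.finrank F K ≤ Module.finrank F Q by omega)
  refine ⟨Q.subtype ∘ₗ g, (Submodule.eq_bot_iff _).2 fun v hv => ?_⟩
  have h0 := (Submodule.disjoint_def.1 hQ.disjoint) _ hv (g v).2
  exact hg (by simpa using h0)

theorem IsCode.injective {I : Type*} {k r : ℕ} {Φ : I → Submodule F V} (h : IsCode k r Φ)
    (hr : r < k) : Function.Injective Φ := by
  intro i j hij
  by_contra hne
  have := h.2 i j hne
  rw [hij, inf_idem, h.1] at this
  omega

theorem IsCode.sumElim {I J : Type*} {k r : ℕ} {Φ : I → Submodule F V} {Ψ : J → Submodule F V}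
    (hΦ : IsCode k r Φ) (hΨ : IsCode k r Ψ)
    (h : ∀ i j, Module.finrank F ↥(Φ i ⊓ Ψ j) ≤ r) : IsCode k r (Sum.elim Φ Ψ) := by
  refine ⟨by rintro (i | i); exacts [hΦ.1 i, hΨ.1 i], ?_⟩
  rintro (i | i) (j | j) hij
  · exact hΦ.2 i j (by simpa using hij)
  · exact h i j
  · rw [inf_comm]
    exact h j i
  · exact hΨ.2 i j (by simpa using hij)

end LinearAlgebra

section Frobenius

variable {V K : Type*} [AddCommGroup V] [Module (ZMod 2) V] [Field K] [Algebra (ZMod 2) K]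

/-- The linear map `v ↦ (ι v) ^ (2 ^ i)`. -/
def powMap [CharP K 2] (ι : V →ₗ[ZMod 2] K) (i : ℕ) : V →ₗ[ZMod 2] K :=
  ((iterateFrobenius K 2 i).toAddMonoidHom.comp ι.toAddMonoidHom).toZModLinearMap 2

theorem powMap_apply [CharP K 2] (ι : V →ₗ[ZMod 2] K) (i : ℕ) (v : V) :
    powMap ι i v = ι v ^ 2 ^ i := by
  simp [powMap, iterateFrobenius_def]

/-- The linear map `v ↦ ∑ i, a i * (ι v) ^ (2 ^ i)` given by a linearized polynomial. -/
def linPoly [CharP K 2] (ι : V →ₗ[ZMod 2] K) {r : ℕ} (a : Fin r → K) : V →ₗ[ZMod 2] K :=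
  ∑ i, (LinearMap.mulLeft (ZMod 2) (a i)) ∘ₗ powMap ι i

theorem linPoly_apply [CharP K 2] (ι : V →ₗ[ZMod 2] K) {r : ℕ} (a : Fin r → K) (v : V) :
    linPoly ι a v = ∑ i, a i * ι v ^ 2 ^ (i : ℕ) := by
  simp [linPoly, powMap_apply]

theorem linPoly_sub [CharP K 2] (ι : V →ₗ[ZMod 2] K) {r : ℕ} (a b : Fin r → K) :
    linPoly ι (a - b) = linPoly ι a - linPoly ι b := by
  ext v
  simp [linPoly_apply, sub_mul]

theorem linPoly_smul [CharP K 2] (ι : V →ₗ[ZMod 2] K) {r : ℕ} (c : K) (a : Fin r → K) (v : V) :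
    linPoly ι (c • a) v = c * linPoly ι a v := by
  simp [linPoly_apply, Finset.mul_sum, mul_assoc]

theorem linPoly_snoc [CharP K 2] (ι : V →ₗ[ZMod 2] K) {r : ℕ} (a : Fin r → K) (c : K) (v : V) :
    linPoly ι (Fin.snoc a c : Fin (r + 1) → K) v = linPoly ι a v + c * powMap ι r v := by
  simp [linPoly_apply, powMap_apply, Fin.sum_univ_castSucc]

theorem finrank_inf_ker_linPoly_lt [CharP K 2] [Finite V] {ι : V →ₗ[ZMod 2] K}
    {N : Submodule (ZMod 2) V} (hι : N ⊓ LinearMap.ker ι = ⊥) {r : ℕ} {a : Fin r → K}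
    (ha : a ≠ 0) : Module.finrank (ZMod 2) ↥(N ⊓ LinearMap.ker (linPoly ι a)) < r := by
  classical
  obtain ⟨i₀, hi₀⟩ := Function.ne_iff.1 ha
  have hr : 0 < r := i₀.pos
  let p : Polynomial K := ∑ i : Fin r, Polynomial.monomial (2 ^ (i : ℕ)) (a i)
  have hp : p ≠ 0 := by
    intro h
    apply hi₀
    have := congrArg (fun q => Polynomial.coeff q (2 ^ (i₀ : ℕ))) h
    simpa [p, Polynomial.finsetSum_coeff, Polynomial.coeff_monomial, Fin.val_inj] using this
  have hdeg : p.natDegree ≤ 2 ^ (r - 1) := by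
    refine Polynomial.natDegree_sum_le_of_forall_le _ _ fun i _ => ?_
    refine (Polynomial.natDegree_monomial_le _).trans ?_
    exact Nat.pow_le_pow_right two_pos (by omega)
  set W := N ⊓ LinearMap.ker (linPoly ι a) with hW
  have hmem : ∀ v : W, ι v ∈ p.roots.toFinset := by
    intro v
    have := v.2.2
    rw [SetLike.mem_coe, LinearMap.mem_ker, linPoly_apply] at this
    simpa [hp, p, Polynomial.eval_finsetSum] using this
  have hinj : Function.Injective (fun v : W => (⟨ι v, hmem v⟩ : p.roots.toFinset)) := by
    intro v w hvw
    have h1 : ι (v - w : V) = 0 := by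
      rw [map_sub, sub_eq_zero]
      simpa using hvw
    have h2 : (v - w : V) ∈ N ⊓ LinearMap.ker ι := ⟨N.sub_mem v.2.1 w.2.1, h1⟩
    rw [hι, Submodule.mem_bot, sub_eq_zero] at h2
    exact Subtype.ext h2
  have hcard := Nat.card_le_card_of_injective _ hinj
  rw [Module.natCard_eq_pow_finrank (K := ZMod 2), Nat.card_zmod, Nat.card_eq_fintype_card,
    Fintype.card_coe] at hcard
  have h3 := hcard.trans ((Multiset.toFinset_card_le _).trans ((Polynomial.card_roots' p).trans hdeg))
  have := (Nat.pow_le_pow_iff_right (by norm_num)).1 h3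
  omega

theorem finrank_span_pair_one (h : K) :
    Module.finrank (ZMod 2) (Submodule.span (ZMod 2) {((h, 1) : K × ZMod 2)}) = 1 :=
  finrank_span_singleton (by simp)

end Frobenius

section Lifting

variable {V E K : Type*} [AddCommGroup V] [Module (ZMod 2) V] [AddCommGroup E] [Module (ZMod 2) E]
  [Field K] [Algebra (ZMod 2) K] [CharP K 2]

/-- Rank metric codes: maximum rank distance codes realized by linearized polynomials. -/
theorem exists_rankMetricCode [Finite V] [Finite E] [Finite K] (N : Submodule (ZMod 2) V)
    (P : Submodule (ZMod 2) E) (r : ℕ)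
    (hN : Module.finrank (ZMod 2) N ≤ Module.finrank (ZMod 2) K)
    (hP : Module.finrank (ZMod 2) K + Module.finrank (ZMod 2) P ≤ Module.finrank (ZMod 2) E) :
    ∃ f : (Fin r → K) → (V →ₗ[ZMod 2] E), ∀ a b, a ≠ b →
      Module.finrank (ZMod 2) ↥(N ⊓ P.comap (f a - f b)) < r := by
  obtain ⟨ι, hι⟩ := exists_linearMap_inf_ker_eq_bot N hN
  obtain ⟨j, hj⟩ := exists_linearMap_comap_eq_bot P hP
  refine ⟨fun a => j ∘ₗ linPoly ι a, fun a b hab => ?_⟩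
  rw [← LinearMap.comp_sub, ← linPoly_sub, Submodule.comap_comp, hj, Submodule.comap_bot]
  exact finrank_inf_ker_linPoly_lt hι (sub_ne_zero.2 hab)

theorem exists_twist [Finite V] [Finite K] {ι : V →ₗ[ZMod 2] K} {N : Submodule (ZMod 2) V}
    (hι : N ⊓ LinearMap.ker ι = ⊥) {r : ℕ} (hN : Module.finrank (ZMod 2) N = r + 1)
    (hK : r + 1 < Module.finrank (ZMod 2) K) :
    ∃ t : K, ∀ a : Fin r → K, ∃ v ∈ N,
      linPoly ι a v + t * powMap ι r v ∉ Submodule.span (ZMod 2) {(1 : K)} := by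
  by_contra! hcon
  choose a ha using hcon
  let g (t : K) : V →ₗ[ZMod 2] K := linPoly ι (a t) + LinearMap.mulLeft (ZMod 2) t ∘ₗ powMap ι r
  let ψ (t : K) : N →ₗ[ZMod 2] Submodule.span (ZMod 2) {(1 : K)} :=
    ((g t).domRestrict N).codRestrict _ fun v => ha t v v.2
  have hψ : Function.Injective ψ := by
    intro t t' htt
    by_contra hne
    have hz : (Fin.snoc (a t - a t') (t - t') : Fin (r + 1) → K) ≠ 0 := by
      intro h0
      have := congrFun h0 (Fin.last r)
      rw [Fin.snoc_last] at this
      exact hne (sub_eq_zero.1 this)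
    have hlt := finrank_inf_ker_linPoly_lt hι hz
    rw [inf_eq_left.2, hN] at hlt
    · exact lt_irrefl _ hlt
    · intro v hv
      have h1 : g t v = g t' v := congrArg Subtype.val (LinearMap.congr_fun htt ⟨v, hv⟩)
      simp only [g, LinearMap.add_apply, LinearMap.comp_apply, LinearMap.mulLeft_apply] at h1
      rw [LinearMap.mem_ker, linPoly_snoc, linPoly_sub, LinearMap.sub_apply]
      linear_combination h1
  have : Finite (N →ₗ[ZMod 2] Submodule.span (ZMod 2) {(1 : K)}) := DFunLike.finite _
  have hcard := Nat.card_le_card_of_injective ψ hψ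
  rw [Module.natCard_eq_pow_finrank (K := ZMod 2),
    Module.natCard_eq_pow_finrank (K := ZMod 2) (V := N →ₗ[ZMod 2] _),
    Module.finrank_linearMap, finrank_span_singleton one_ne_zero, hN, Nat.card_zmod] at hcard
  have := (Nat.pow_le_pow_iff_right (by norm_num)).1 hcard
  omega

/-- A subspace `N` of dimension `r + 1` lifts to a family of `|K| ^ (r + 1)` subspaces of
`V × (K × 𝔽₂)` of dimension `r + 2`, all projecting onto `N`, that pairwise meet in dimension
at most `r`. -/
theorem exists_twistedLift [Finite V] [Finite K] (N : Submodule (ZMod 2) V) (r : ℕ)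
    (hN : Module.finrank (ZMod 2) N = r + 1) (hK : r + 1 < Module.finrank (ZMod 2) K) :
    ∃ f : K × (Fin r → K) → (V →ₗ[ZMod 2] K × ZMod 2),
      IsCode (r + 2) r fun x => graphAdd N (f x) (Submodule.span (ZMod 2) {(x.1, 1)}) := by
  obtain ⟨ι, hι⟩ := exists_linearMap_inf_ker_eq_bot (K := K) N (by omega)
  obtain ⟨t, ht⟩ := exists_twist hι hN hK
  refine ⟨fun x => LinearMap.inl (ZMod 2) K (ZMod 2) ∘ₗ
    (linPoly ι x.2 + LinearMap.mulLeft (ZMod 2) (t * x.1) ∘ₗ powMap ι r), fun x => ?_, ?_⟩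
  · rw [finrank_graphAdd, hN, finrank_span_pair_one]
  rintro ⟨h, a⟩ ⟨h', a'⟩ hne
  rcases eq_or_ne h h' with rfl | hh
  · have haa : a ≠ a' := fun h0 => hne (by rw [h0])
    refine (finrank_graphAdd_inf_le_of_same _ _ _ _).trans ?_
    rw [finrank_span_pair_one, Nat.add_one_le_iff]
    refine lt_of_le_of_lt (Submodule.finrank_mono (inf_le_inf_left N ?_))
      (finrank_inf_ker_linPoly_lt hι (sub_ne_zero.2 haa))
    intro v hv
    obtain ⟨c, hc⟩ := Submodule.mem_span_singleton.1 (Submodule.mem_comap.1 hv)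
    simp only [Prod.smul_mk, LinearMap.sub_apply, LinearMap.comp_apply, LinearMap.inl_apply,
      Prod.mk_sub_mk, Prod.mk.injEq, LinearMap.add_apply, smul_eq_mul, mul_one, sub_zero] at hc
    rw [hc.2, zero_smul] at hc
    rw [LinearMap.mem_ker, linPoly_sub, LinearMap.sub_apply]
    linear_combination -hc.1
  · by_contra! hlt
    have hbot : Submodule.span (ZMod 2) {((h, 1) : K × ZMod 2)} ⊓
        Submodule.span (ZMod 2) {((h', 1) : K × ZMod 2)} = ⊥ := by
      refine (Submodule.eq_bot_iff _).2 ?_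
      rintro w ⟨hw, hw'⟩
      obtain ⟨c, rfl⟩ := Submodule.mem_span_singleton.1 hw
      obtain ⟨c', hc'⟩ := Submodule.mem_span_singleton.1 hw'
      simp only [Prod.smul_mk, smul_eq_mul, mul_one, Prod.mk.injEq] at hc'
      obtain ⟨h1, rfl⟩ := hc'
      have h2 : c' • (h' - h) = 0 := by rw [smul_sub, h1, sub_self]
      rcases smul_eq_zero.1 h2 with h3 | h3
      · rw [h3, zero_smul]
      · exact absurd (sub_eq_zero.1 h3).symm hh
    rw [finrank_eq_map_fst_add_comap_inr, Submodule.comap_inf, comap_inr_graphAdd,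
      comap_inr_graphAdd, hbot, finrank_bot, add_zero] at hlt
    have hle : ∀ X Y : Submodule (ZMod 2) (V × (K × ZMod 2)),
        (X ⊓ Y).map (LinearMap.fst _ _ _) ≤ X.map (LinearMap.fst _ _ _) :=
      fun X Y => Submodule.map_mono inf_le_left
    have heq := Submodule.eq_of_le_of_finrank_le
      ((hle _ _).trans_eq (map_fst_graphAdd _ _ _)) (by rw [hN]; exact hlt)
    obtain ⟨v, hv, hv'⟩ := ht ((h - h')⁻¹ • (a - a'))
    rw [← heq] at hv
    obtain ⟨⟨v', w⟩, ⟨hx, hy⟩, rfl⟩ := hv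
    rw [SetLike.mem_coe, mem_graphAdd] at hx hy
    obtain ⟨c, hc⟩ := Submodule.mem_span_singleton.1 hx.2
    obtain ⟨c', hc'⟩ := Submodule.mem_span_singleton.1 hy.2
    rw [Prod.ext_iff] at hc hc'
    simp only [Prod.smul_mk, smul_eq_mul, mul_one, LinearMap.mulLeft_mul, LinearMap.coe_comp,
      LinearMap.coe_inl, Function.comp_apply, LinearMap.add_apply, LinearMap.mulLeft_apply,
      Prod.fst_sub, Prod.snd_sub, sub_zero] at hc hc'
    apply hv'
    refine Submodule.mem_span_singleton.2 ⟨-c, ?_⟩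
    obtain ⟨h1, h2⟩ := hc
    obtain ⟨h1', h2'⟩ := hc'
    rw [h2', ← h2] at h1'
    have hd : h - h' ≠ 0 := sub_ne_zero.2 hh
    rw [Algebra.smul_def] at h1 h1' ⊢
    rw [linPoly_smul, linPoly_sub, LinearMap.sub_apply, LinearMap.fst_apply, map_neg]
    field_simp
    linear_combination h1' - h1

end Lifting

section Parallelism

/-- Pairs of vectors of `𝔽₂⁴`, as binary numbers, spanning the lines of a parallelism
of `PG(3, 2)`. -/
def parallelismData : Fin 7 → Fin 5 → ℕ × ℕ :=
  ![![(1, 2), (4, 8), (5, 10), (6, 11), (7, 9)],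
    ![(1, 4), (2, 8), (3, 13), (6, 9), (7, 11)],
    ![(1, 6), (2, 9), (3, 12), (4, 10), (5, 8)],
    ![(1, 8), (2, 12), (3, 5), (4, 11), (7, 10)],
    ![(1, 10), (2, 13), (3, 4), (5, 9), (6, 8)],
    ![(1, 12), (2, 4), (3, 9), (5, 11), (7, 8)],
    ![(1, 14), (2, 5), (3, 8), (4, 9), (6, 10)]]

/-- The vector of binary digits of a number. -/
def bitVector (n : ℕ) : Fin 4 → ZMod 2 := fun i => if n.testBit i then 1 else 0

/-- The line of `PG(3, 2)` spanned by an entry of `parallelismData`. -/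
def parallelismLine (i : Fin 7) (j : Fin 5) : Submodule (ZMod 2) (Fin 4 → ZMod 2) :=
  Submodule.span (ZMod 2)
    {bitVector (parallelismData i j).1, bitVector (parallelismData i j).2}

theorem finrank_parallelismLine (i : Fin 7) (j : Fin 5) :
    Module.finrank (ZMod 2) (parallelismLine i j) = 2 := by
  have h : ∀ i j, ∀ s t : ZMod 2, s • bitVector (parallelismData i j).1 +
      t • bitVector (parallelismData i j).2 = 0 → s = 0 ∧ t = 0 := by decide +kernel
  have := finrank_span_eq_card (LinearIndependent.pair_iff.2 (h i j))
  rwa [Matrix.range_cons_cons_empty, Fintype.card_fin] at this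

theorem parallelismLine_inf_eq_bot (i : Fin 7) {j j' : Fin 5} (hj : j ≠ j') :
    parallelismLine i j ⊓ parallelismLine i j' = ⊥ := by
  have h : ∀ i j j', j ≠ j' → ∀ s t s' t' : ZMod 2,
      s' • bitVector (parallelismData i j').1 + t' • bitVector (parallelismData i j').2 =
      s • bitVector (parallelismData i j).1 + t • bitVector (parallelismData i j).2 →
      s • bitVector (parallelismData i j).1 + t • bitVector (parallelismData i j).2 = 0 := by
    decide +kernel
  refine (Submodule.eq_bot_iff _).2 ?_
  rintro v ⟨hv, hv'⟩
  obtain ⟨s, t, rfl⟩ := Submodule.mem_span_pair.1 hv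
  obtain ⟨s', t', h'⟩ := Submodule.mem_span_pair.1 hv'
  exact h i j j' hj s t s' t' h'

theorem finrank_parallelismLine_inf_le {i i' : Fin 7} (hi : i ≠ i') (j j' : Fin 5) :
    Module.finrank (ZMod 2) ↥(parallelismLine i j ⊓ parallelismLine i' j') ≤ 1 := by
  have h : ∀ i j i' j', i ≠ i' → ¬ ((∃ s t : ZMod 2,
      s • bitVector (parallelismData i' j').1 + t • bitVector (parallelismData i' j').2 =
      bitVector (parallelismData i j).1) ∧ ∃ s t : ZMod 2,
      s • bitVector (parallelismData i' j').1 + t • bitVector (parallelismData i' j').2 =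
      bitVector (parallelismData i j).2) := by
    decide +kernel
  by_contra! hlt
  have heq := Submodule.eq_of_le_of_finrank_le
    (inf_le_left : parallelismLine i j ⊓ parallelismLine i' j' ≤ _)
    (by rw [finrank_parallelismLine]; exact hlt)
  have hle := inf_eq_left.1 heq
  exact h i j i' j' hi
    ⟨Submodule.mem_span_pair.1 (hle (Submodule.mem_span_pair.2 ⟨1, 0, by simp⟩)),
      Submodule.mem_span_pair.1 (hle (Submodule.mem_span_pair.2 ⟨0, 1, by simp⟩))⟩

/-- The lines of `PG(3, 2)` have a parallelism: a partition into seven spreads. -/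
theorem exists_parallelism (V : Type*) [AddCommGroup V] [Module (ZMod 2) V]
    [FiniteDimensional (ZMod 2) V] (hV : Module.finrank (ZMod 2) V = 4) :
    ∃ P : Fin 7 → Fin 5 → Submodule (ZMod 2) V,
      (∀ i j, Module.finrank (ZMod 2) (P i j) = 2) ∧
      (∀ i j j', j ≠ j' → P i j ⊓ P i j' = ⊥) ∧
      ∀ i j i' j', i ≠ i' → Module.finrank (ZMod 2) ↥(P i j ⊓ P i' j') ≤ 1 := by
  let e : (Fin 4 → ZMod 2) ≃ₗ[ZMod 2] V := LinearEquiv.ofFinrankEq _ _ (by simp [hV])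
  refine ⟨fun i j => (parallelismLine i j).map (e : (Fin 4 → ZMod 2) →ₗ[ZMod 2] V),
    fun i j => ?_, fun i j j' hj => ?_, fun i j i' j' hi => ?_⟩
  · rw [LinearEquiv.finrank_map_eq, finrank_parallelismLine]
  · rw [← Submodule.map_inf _ e.injective, parallelismLine_inf_eq_bot i hj, Submodule.map_bot]
  · rw [← Submodule.map_inf _ e.injective, LinearEquiv.finrank_map_eq]
    exact finrank_parallelismLine_inf_le hi j j'

end Parallelism

section Construction

variable {A B V E : Type} [AddCommGroup A] [Module (ZMod 2) A] [AddCommGroup B] [Module (ZMod 2) B]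
  [AddCommGroup V] [Module (ZMod 2) V] [AddCommGroup E] [Module (ZMod 2) E]

theorem natCard_fun_galoisField (r : ℕ) {n : ℕ} (hn : n ≠ 0) :
    Nat.card (Fin r → GaloisField 2 n) = 2 ^ (n * r) := by
  rw [Nat.card_fun, GaloisField.card 2 n hn, Nat.card_fin, pow_mul]

/-- The linkage of a code in `V` with a maximum rank distance code of linear maps `V → E`. -/
theorem exists_linkage [Finite V] [Finite E] {n k r : ℕ} (hn : n ≠ 0) (hk : k ≤ n)
    (hE : Module.finrank (ZMod 2) E = n) {I : Type} {Φ : I → Submodule (ZMod 2) V}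
    (hΦ : IsCode k (r - 1) Φ) :
    ∃ f : I → (Fin r → GaloisField 2 n) → (V →ₗ[ZMod 2] E),
      IsCode k (r - 1) fun x : I × (Fin r → GaloisField 2 n) =>
        graphAdd (Φ x.1) (f x.1 x.2) ⊥ := by
  have h := fun i => exists_rankMetricCode (K := GaloisField 2 n) (Φ i)
    (⊥ : Submodule (ZMod 2) E) r (by rw [hΦ.1, GaloisField.finrank 2 hn]; exact hk)
    (by rw [finrank_bot, GaloisField.finrank 2 hn, hE, add_zero])
  choose f hf using h
  refine ⟨f, fun x => by rw [finrank_graphAdd, hΦ.1, finrank_bot, add_zero], ?_⟩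
  rintro ⟨i, a⟩ ⟨j, b⟩ hne
  rcases eq_or_ne i j with rfl | hij
  · have hab : a ≠ b := fun h0 => hne (by rw [h0])
    refine (finrank_graphAdd_inf_le_of_same _ _ _ _).trans ?_
    rw [finrank_bot, add_zero]
    exact Nat.le_sub_one_of_lt (hf i a b hab)
  · refine (finrank_graphAdd_inf_le _ _ _ _ _ _).trans ?_
    rw [inf_idem, finrank_bot, add_zero]
    exact hΦ.2 i j hij

/-- The code obtained by combining a parallelism of `A` with a parallelism of `B`. -/
theorem exists_parallelCode [Finite A] [Finite B] (hB : Module.finrank (ZMod 2) B = 4)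
    {P : Fin 7 → Fin 5 → Submodule (ZMod 2) A} {Q : Fin 7 → Fin 5 → Submodule (ZMod 2) B}
    (hP₁ : ∀ i j, Module.finrank (ZMod 2) (P i j) = 2)
    (hP₂ : ∀ i j j', j ≠ j' → P i j ⊓ P i j' = ⊥)
    (hP₃ : ∀ i j i' j', i ≠ i' → Module.finrank (ZMod 2) ↥(P i j ⊓ P i' j') ≤ 1)
    (hQ₁ : ∀ i j, Module.finrank (ZMod 2) (Q i j) = 2)
    (hQ₂ : ∀ i j j', j ≠ j' → Q i j ⊓ Q i j' = ⊥)
    (hQ₃ : ∀ i j i' j', i ≠ i' → Module.finrank (ZMod 2) ↥(Q i j ⊓ Q i' j') ≤ 1) :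
    ∃ f : Fin 7 → Fin 5 → Fin 5 → (Fin 1 → GaloisField 2 2) → (A →ₗ[ZMod 2] B),
      IsCode 4 2 fun x : Fin 7 × Fin 5 × Fin 5 × (Fin 1 → GaloisField 2 2) =>
        graphAdd (P x.1 x.2.1) (f x.1 x.2.1 x.2.2.1 x.2.2.2) (Q x.1 x.2.2.1) := by
  have h := fun i j l => exists_rankMetricCode (K := GaloisField 2 2) (P i j) (Q i l) 1
    (by rw [hP₁, GaloisField.finrank 2 two_ne_zero])
    (by rw [hQ₁, GaloisField.finrank 2 two_ne_zero, hB])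
  choose f hf using h
  refine ⟨f, fun x => by rw [finrank_graphAdd, hP₁, hQ₁], ?_⟩
  rintro ⟨i, j, l, a⟩ ⟨i', j', l', a'⟩ hne
  have hle := finrank_graphAdd_inf_le (P i j) (P i' j') (f i j l a) (f i' j' l' a')
    (Q i l) (Q i' l')
  dsimp only
  rcases eq_or_ne i i' with rfl | hi
  · rcases eq_or_ne j j' with rfl | hj
    · rcases eq_or_ne l l' with rfl | hl
      · have ha : a ≠ a' := fun h0 => hne (by rw [h0])
        refine (finrank_graphAdd_inf_le_of_same _ _ _ _).trans ?_
        have := hf i j l a a' ha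
        rw [hQ₁]
        omega
      · rwa [hQ₂ i l l' hl, finrank_bot, inf_idem, hP₁] at hle
    · rw [hP₂ i j j' hj, finrank_bot, zero_add] at hle
      exact hle.trans ((Submodule.finrank_mono inf_le_left).trans_eq (hQ₁ i l))
  · exact hle.trans (Nat.add_le_add (hP₃ i j i' j' hi) (hQ₃ i l i' l' hi))

/-- In an eight-dimensional space there are a code of 4797 four-dimensional subspaces pairwise
meeting in dimension at most two, and a code of 88 three-dimensional subspaces pairwise meeting
in dimension at most one, none of which lies in a member of the first code. -/
theorem exists_code_and_planes :
    ∃ (I J : Type) (_ : Finite I) (_ : Finite J)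
      (Φ : I → Submodule (ZMod 2) ((Fin 4 → ZMod 2) × GaloisField 2 3 × ZMod 2))
      (Ψ : J → Submodule (ZMod 2) ((Fin 4 → ZMod 2) × GaloisField 2 3 × ZMod 2)),
      Nat.card I = 4797 ∧ 88 ≤ Nat.card J ∧ IsCode 4 2 Φ ∧ IsCode 3 1 Ψ ∧
        ∀ i j, ¬ Ψ j ≤ Φ i := by
  classical
  have hA : Module.finrank (ZMod 2) (Fin 4 → ZMod 2) = 4 := by simp
  have hB : Module.finrank (ZMod 2) (GaloisField 2 3 × ZMod 2) = 4 := by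
    rw [Module.finrank_prod, GaloisField.finrank 2 three_ne_zero, Module.finrank_self]
  have hG : Module.finrank (ZMod 2) (GaloisField 2 3) = 3 := GaloisField.finrank 2 three_ne_zero
  obtain ⟨P, hP₁, hP₂, hP₃⟩ := exists_parallelism _ hA
  obtain ⟨Q, hQ₁, hQ₂, hQ₃⟩ := exists_parallelism _ hB
  obtain ⟨f, hf⟩ := exists_linkage (r := 3) (Φ := fun _ : Unit => (⊤ : Submodule (ZMod 2) _))
    four_ne_zero le_rfl hB ⟨fun _ => by rw [finrank_top, hA],
      fun i j hij => absurd rfl hij⟩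
  obtain ⟨g, hg⟩ := exists_parallelCode hB hP₁ hP₂ hP₃ hQ₁ hQ₂ hQ₃
  have htop : IsCode 4 2 fun _ : Unit =>
      graphAdd (⊥ : Submodule (ZMod 2) (Fin 4 → ZMod 2)) 0
        (⊤ : Submodule (ZMod 2) (GaloisField 2 3 × ZMod 2)) :=
    ⟨fun _ => by rw [finrank_graphAdd, finrank_bot, finrank_top, hB],
      fun i j hij => absurd rfl hij⟩
  have hcode := (hf.sumElim hg fun x y => by
      refine (finrank_graphAdd_inf_le _ _ _ _ _ _).trans ?_
      rw [top_inf_eq, bot_inf_eq, hP₁, finrank_bot]).sumElim htop fun x y => by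
    rcases x with x | x
    · refine (finrank_graphAdd_inf_le _ _ _ _ _ _).trans ?_
      rw [inf_bot_eq, bot_inf_eq, finrank_bot, finrank_bot]
      exact Nat.zero_le _
    · refine (finrank_graphAdd_inf_le _ _ _ _ _ _).trans ?_
      rw [inf_bot_eq, inf_top_eq, finrank_bot, hQ₁]
  have ht := fun e => exists_twistedLift (K := GaloisField 2 3) (P 0 e) 1 (hP₁ 0 e)
    (by rw [hG]; norm_num)
  choose u hu using ht
  obtain ⟨c, hc⟩ : ∃ c : Fin 2 → Fin 5, Function.Injective c :=
    ⟨_, Fin.castLE_injective (by norm_num : 2 ≤ 5)⟩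
  let Ψ (x : Fin 2 × GaloisField 2 3 × (Fin 1 → GaloisField 2 3)) :
      Submodule (ZMod 2) ((Fin 4 → ZMod 2) × GaloisField 2 3 × ZMod 2) :=
    graphAdd (P 0 (c x.1)) (u (c x.1) x.2) (Submodule.span (ZMod 2) {(x.2.1, 1)})
  have hΨ : IsCode 3 1 Ψ := by
    refine ⟨fun x => (hu _).1 x.2, ?_⟩
    rintro ⟨e, x⟩ ⟨e', x'⟩ hne
    rcases eq_or_ne e e' with rfl | he
    · exact (hu _).2 x x' fun h0 => hne (by rw [h0])
    · refine (finrank_graphAdd_inf_le _ _ _ _ _ _).trans ?_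
      rw [hP₂ _ _ _ fun h0 => he (hc h0), finrank_bot, zero_add]
      exact (Submodule.finrank_mono inf_le_left).trans_eq (finrank_span_pair_one _)
  have hfst (x) : (Ψ x).map (LinearMap.fst _ _ _) = P 0 (c x.1) :=
    map_fst_graphAdd _ _ _
  have hinr (x) : Module.finrank (ZMod 2) ((Ψ x).comap (LinearMap.inr _ _ _)) = 1 := by
    rw [comap_inr_graphAdd, finrank_span_pair_one]
  set Φ := Sum.elim (Sum.elim (fun x : Unit × (Fin 3 → GaloisField 2 4) =>
    graphAdd ⊤ (f x.1 x.2) ⊥) _) _ with hΦ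
  have hbad : ∀ x, (∃ i, Ψ x ≤ Φ i) → ∃ y : Fin 5 × (Fin 1 → GaloisField 2 2),
      Ψ x ≤ Φ (Sum.inl (Sum.inr (0, c x.1, y))) := by
    rintro x ⟨(i | ⟨i, j, l, a⟩) | i, hi⟩
    · have h1 := Submodule.finrank_mono (Submodule.comap_mono (f := LinearMap.inr _ _ _) hi)
      have h2 : (Φ (Sum.inl (Sum.inl i))).comap (LinearMap.inr _ _ _) = ⊥ :=
        comap_inr_graphAdd _ _ _
      rw [hinr, h2, finrank_bot] at h1
      omega
    · have h1 := Submodule.map_mono (f := LinearMap.fst _ _ _) hi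
      rw [hfst] at h1
      simp only [hΦ, Sum.elim_inl, Sum.elim_inr, map_fst_graphAdd] at h1
      have h2 := inf_eq_left.2 h1
      have hi0 : i = 0 := by
        by_contra hne
        have h3 := hP₃ 0 (c x.1) i j (Ne.symm hne)
        rw [h2, hP₁] at h3
        omega
      subst hi0
      have hj : c x.1 = j := by
        by_contra hne
        rw [hP₂ _ _ _ hne] at h2
        have h3 := hP₁ 0 (c x.1)
        rw [← h2, finrank_bot] at h3
        omega
      subst hj
      exact ⟨(l, a), hi⟩
    · have h1 := Submodule.finrank_mono (Submodule.map_mono (f := LinearMap.fst _ _ _) hi)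
      have h2 : (Φ (Sum.inr i)).map (LinearMap.fst _ _ _) = ⊥ := map_fst_graphAdd _ _ _
      rw [hfst, hP₁, h2, finrank_bot] at h1
      omega
  let Bad := {x // ∃ i, Ψ x ≤ Φ i}
  choose y hy using fun x : Bad => hbad x x.2
  have hinj : Function.Injective fun x : Bad => (x.1.1, y x) := by
    intro x x' hxx
    by_contra hne
    have h1 : Module.finrank (ZMod 2) ↥(Ψ x ⊓ Ψ x') ≤ 1 := hΨ.2 _ _ fun h0 => hne (Subtype.ext h0)
    simp only [Prod.mk.injEq] at hxx
    have h2 := hy x'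
    rw [← hxx.1, ← hxx.2] at h2
    have h3 := Submodule.finrank_mono (sup_le (hy x) h2)
    rw [hcode.1] at h3
    have h4 := Submodule.finrank_sup_add_finrank_inf_eq (Ψ x) (Ψ x')
    rw [hΨ.1, hΨ.1] at h4
    omega
  have hcard := Nat.card_le_card_of_injective _ hinj
  refine ⟨_, {x // ¬ ∃ i, Ψ x ≤ Φ i}, inferInstance, inferInstance, Φ, fun x => Ψ x, ?_, ?_,
    hcode, ⟨fun x => hΨ.1 x, fun x x' h => hΨ.2 _ _ fun h0 => h (Subtype.ext h0)⟩,
    fun i x h => x.2 ⟨i, h⟩⟩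
  · simp [Nat.card_sum, Nat.card_prod, natCard_fun_galoisField _ two_ne_zero,
      natCard_fun_galoisField _ four_ne_zero]
  · have h1 := Nat.card_congr (Equiv.sumCompl fun x => ∃ i, Ψ x ≤ Φ i)
    simp only [Nat.card_sum, Nat.card_prod, natCard_fun_galoisField _ two_ne_zero,
      natCard_fun_galoisField _ three_ne_zero, GaloisField.card 2 3 three_ne_zero,
      Nat.card_fin] at h1 hcard
    change Nat.card Bad + _ = _ at h1
    omega

theorem four_le_subspaceDist {F W : Type*} [Field F] [AddCommGroup W] [Module F W]
    [FiniteDimensional F W] {X Y : Submodule F W} (hX : Module.finrank F X = 4)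
    (hY : Module.finrank F Y = 4) (h : Module.finrank F ↥(X ⊓ Y) ≤ 2) :
    4 ≤ subspaceDist X Y := by
  have := Submodule.finrank_sup_add_finrank_inf_eq X Y
  unfold subspaceDist
  omega

end Construction

theorem statement13 :
    ∃ S : Set (Submodule (ZMod 2) (Fin 14 → ZMod 2)),
      S.ncard = 1259180741 ∧
      (∀ X ∈ S, Module.finrank (ZMod 2) ↥X = 4) ∧
      (∀ X ∈ S, ∀ Y ∈ S, X ≠ Y → 4 ≤ subspaceDist X Y) := by
  obtain ⟨I, J, _, _, Φ, Ψ, hI, hJ, hΦ, hΨ, hΨΦ⟩ := exists_code_and_planes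
  have h6 : Module.finrank (ZMod 2) (GaloisField 2 5 × ZMod 2) = 6 := by
    rw [Module.finrank_prod, GaloisField.finrank 2 (by norm_num), Module.finrank_self]
  obtain ⟨f, hf⟩ := exists_linkage (r := 3) (n := 6) (by norm_num) (by norm_num) h6 hΦ
  have ht := fun j => exists_twistedLift (K := GaloisField 2 5) (Ψ j) 2 (hΨ.1 j)
    (by rw [GaloisField.finrank 2 (by norm_num)]; norm_num)
  choose u hu using ht
  have hlift : IsCode 4 2 fun x : J × GaloisField 2 5 × (Fin 2 → GaloisField 2 5) =>
      graphAdd (Ψ x.1) (u x.1 x.2) (Submodule.span (ZMod 2) {(x.2.1, 1)}) := by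
    refine ⟨fun x => (hu _).1 x.2, ?_⟩
    rintro ⟨j, x⟩ ⟨j', x'⟩ hne
    rcases eq_or_ne j j' with rfl | hj
    · exact (hu _).2 x x' fun h0 => hne (by rw [h0])
    · exact (finrank_graphAdd_inf_le _ _ _ _ _ _).trans (Nat.add_le_add (hΨ.2 j j' hj)
        ((Submodule.finrank_mono inf_le_left).trans_eq (finrank_span_pair_one _)))
  have hcode := hf.sumElim hlift fun x y => by
    refine (finrank_graphAdd_inf_le _ _ _ _ _ _).trans ?_
    rw [bot_inf_eq, finrank_bot, add_zero]
    by_contra! hlt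
    have heq := Submodule.eq_of_le_of_finrank_le
      (inf_le_right : Φ x.1 ⊓ Ψ y.1 ≤ _) (by rw [hΨ.1]; exact hlt)
    exact hΨΦ x.1 y.1 (inf_eq_right.1 heq)
  let e : (((Fin 4 → ZMod 2) × GaloisField 2 3 × ZMod 2) × GaloisField 2 5 × ZMod 2)
      ≃ₗ[ZMod 2] (Fin 14 → ZMod 2) := LinearEquiv.ofFinrankEq _ _ (by
    rw [Module.finrank_prod, h6, Module.finrank_prod, Module.finrank_prod,
      GaloisField.finrank 2 three_ne_zero, Module.finrank_self, Module.finrank_fin_fun,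
      Module.finrank_fin_fun])
  set Θ := Sum.elim (fun x : I × (Fin 3 → GaloisField 2 6) => graphAdd (Φ x.1) (f x.1 x.2) ⊥) _
    with hΘ
  have hinj : Function.Injective fun x => (Θ x).map e.toLinearMap :=
    (Submodule.map_injective_of_injective e.injective).comp (hcode.injective (by norm_num))
  have hcard : 1259180741 ≤ (Set.range fun x => (Θ x).map e.toLinearMap).ncard := by
    rw [Set.ncard_range_of_injective hinj]
    simp only [Nat.card_sum, Nat.card_prod, hI, GaloisField.card 2 5 (by norm_num),
      natCard_fun_galoisField _ (show 6 ≠ 0 by norm_num),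
      natCard_fun_galoisField _ (show 5 ≠ 0 by norm_num)]
    omega
  obtain ⟨S, hS, hSc⟩ := Set.exists_subset_card_eq hcard
  have hmem : ∀ X ∈ S, ∃ x, (Θ x).map e.toLinearMap = X := fun X hX => hS hX
  refine ⟨S, hSc, fun X hX => ?_, fun X hX Y hY hne => ?_⟩
  · obtain ⟨x, rfl⟩ := hmem X hX
    rw [LinearEquiv.finrank_map_eq, hcode.1]
  · obtain ⟨x, rfl⟩ := hmem X hX
    obtain ⟨y, rfl⟩ := hmem Y hY
    refine four_le_subspaceDist (by rw [LinearEquiv.finrank_map_eq, hcode.1])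
      (by rw [LinearEquiv.finrank_map_eq, hcode.1]) ?_
    rw [← Submodule.map_inf _ e.injective, LinearEquiv.finrank_map_eq]
    exact hcode.2 x y fun h0 => hne (congrArg (fun x => (Θ x).map e.toLinearMap) h0)
end

section
/- Let q be a prime power and suppose there exists a set of N four-dimensional subspaces of F_q^8 whose pairwise subspace distance is at least 4. Then there exists a set of N·q^{21} + (q^{21} + 2q^{19} + 3q^{18} + 5q^{17} + q^{16} + 4q^{15} + 6q^{14} + 11q^{13} + 10q^{12} + 12q^{11} + 9q^{10} + 8q^9 + 4q^8 + 3q^7 + 2q^6 + q^5 + q^4 + q^3 + q^2 + 2q + 1) four-dimensional subspaces of F_q^{15} whose pairwise subspace distance is at least 4; in other words, A_q(15,4,4) ≥ A_q(8,4,4)·q^{21} + q^{21} + 2q^{19} + 3q^{18} + 5q^{17} + q^{16} + 4q^{15} + 6q^{14} + 11q^{13} + 10q^{12} + 12q^{11} + 9q^{10} + 8q^9 + 4q^8 + 3q^7 + 2q^6 + q^5 + q^4 + q^3 + q^2 + 2q + 1. -/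
open Module

/-- `V` contains `N` four-dimensional subspaces meeting pairwise in dimension at most two. -/
def HasPlaneCode (F V : Type*) [Field F] [AddCommGroup V] [Module F V] (N : ℕ) : Prop :=
  ∃ f : Fin N → Submodule F V, (∀ i, finrank F (f i) = 4) ∧
    ∀ i j, i ≠ j → finrank F (f i ⊓ f j : Submodule F V) ≤ 2

section Codes

variable {F V V' : Type*} [Field F] [AddCommGroup V] [Module F V] [AddCommGroup V'] [Module F V']

theorem HasPlaneCode.of_family {ι : Type*} [Fintype ι] {N : ℕ} (hN : N ≤ Fintype.card ι)
    (f : ι → Submodule F V) (hf : ∀ i, finrank F (f i) = 4)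
    (hd : ∀ i j, i ≠ j → finrank F (f i ⊓ f j : Submodule F V) ≤ 2) : HasPlaneCode F V N := by
  obtain ⟨e⟩ : Nonempty (Fin N ↪ ι) := Function.Embedding.nonempty_of_card_le (by simpa using hN)
  exact ⟨fun i => f (e i), fun i => hf _, fun i j hij => hd _ _ (e.injective.ne hij)⟩

theorem HasPlaneCode.map {N : ℕ} (e : V ≃ₗ[F] V') (h : HasPlaneCode F V N) :
    HasPlaneCode F V' N := by
  obtain ⟨f, hf, hd⟩ := h
  refine ⟨fun i => (f i).map (e : V →ₗ[F] V'), fun i => ?_, fun i j hij => ?_⟩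
  · rw [LinearEquiv.finrank_map_eq, hf]
  · rw [← Submodule.map_inf _ e.injective, LinearEquiv.finrank_map_eq]
    exact hd i j hij

theorem four_le_subspaceDist_iff [FiniteDimensional F V] {X Y : Submodule F V}
    (hX : finrank F X = 4) (hY : finrank F Y = 4) :
    4 ≤ subspaceDist X Y ↔ finrank F (X ⊓ Y : Submodule F V) ≤ 2 := by
  have := Submodule.finrank_sup_add_finrank_inf_eq X Y
  unfold subspaceDist
  omega

theorem hasPlaneCode_iff [FiniteDimensional F V] [Finite F] {N : ℕ} :
    HasPlaneCode F V N ↔ ∃ S : Set (Submodule F V), S.ncard = N ∧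
      (∀ X ∈ S, finrank F X = 4) ∧
      (∀ X ∈ S, ∀ Y ∈ S, X ≠ Y → 4 ≤ subspaceDist X Y) := by
  constructor
  · rintro ⟨f, hf, hd⟩
    have hinj : Function.Injective f := by
      intro i j hij
      by_contra h
      have := hd i j h
      rw [hij, inf_idem, hf] at this
      omega
    refine ⟨Set.range f, ?_, ?_, ?_⟩
    · rw [← Nat.card_coe_set_eq, Nat.card_range_of_injective hinj, Nat.card_fin]
    · rintro _ ⟨i, rfl⟩
      exact hf i
    · rintro _ ⟨i, rfl⟩ _ ⟨j, rfl⟩ hij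
      exact (four_le_subspaceDist_iff (hf i) (hf j)).2 (hd i j fun h => hij (h ▸ rfl))
  · rintro ⟨S, hS, hf, hd⟩
    have : Finite V := Module.finite_of_finite F
    have : Fintype S := Fintype.ofFinite S
    refine HasPlaneCode.of_family (ι := S) ?_ (fun X => X.1) (fun X => hf X X.2)
      fun X Y hXY => ?_
    · rw [← hS, ← Nat.card_coe_set_eq, Nat.card_eq_fintype_card]
    · exact (four_le_subspaceDist_iff (hf X X.2) (hf Y Y.2)).1
        (hd X X.2 Y Y.2 fun h => hXY (Subtype.ext h))

/-- A subspace of `V × V'` is controlled by its projection to `V` and its part inside `V'`. -/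
theorem finrank_le_of_fst_of_snd [FiniteDimensional F V] [FiniteDimensional F V']
    (X : Submodule F (V × V')) (P : Submodule F V) (L : Submodule F V')
    (hP : ∀ x ∈ X, x.1 ∈ P) (hL : ∀ x ∈ X, x.1 = 0 → x.2 ∈ L) :
    finrank F X ≤ finrank F P + finrank F L := by
  let φ : X →ₗ[F] P := ((LinearMap.fst F V V').comp X.subtype).codRestrict P fun x => hP x x.2
  have hφ : ∀ x : X, φ x = 0 → x.1.1 = 0 := fun x hx => congrArg Subtype.val hx
  let ψ : LinearMap.ker φ →ₗ[F] L :=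
    ((LinearMap.snd F V V').comp (X.subtype.comp (LinearMap.ker φ).subtype)).codRestrict L
      fun x => hL _ x.1.2 (hφ _ x.2)
  have hψ : Function.Injective ψ := by
    rw [injective_iff_map_eq_zero]
    intro x hx
    have h2 : x.1.1.2 = 0 := congrArg Subtype.val hx
    exact Subtype.ext (Subtype.ext (Prod.ext (hφ _ x.2) h2))
  rw [← LinearMap.finrank_range_add_finrank_ker φ]
  exact add_le_add (Submodule.finrank_le _) (LinearMap.finrank_le_finrank_of_injective hψ)

theorem finrank_inf_le_one {P Q : Submodule F V} [FiniteDimensional F V] (hP : finrank F P = 2)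
    (hQ : finrank F Q = 2) (h : P ≠ Q) : finrank F (P ⊓ Q : Submodule F V) ≤ 1 := by
  by_contra! hlt
  have h1 : P ⊓ Q = P := Submodule.eq_of_le_of_finrank_le inf_le_left (by omega)
  have h2 : P ⊓ Q = Q := Submodule.eq_of_le_of_finrank_le inf_le_right (by omega)
  exact h (h1.symm.trans h2)

end Codes

section Fields

theorem exists_field_extension (F : Type) [Field F] [Finite F] (m : ℕ) (hm : m ≠ 0) :
    ∃ (K : Type) (_ : Field K) (_ : Algebra F K), finrank F K = m := by
  obtain ⟨p, hp⟩ := CharP.exists F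
  have : Fact p.Prime := ⟨CharP.char_is_prime F p⟩
  have : NeZero m := ⟨hm⟩
  exact ⟨FiniteField.Extension F p m, inferInstance, inferInstance,
    FiniteField.finrank_extension F p m⟩

/-- A finite-dimensional space of dimension at least two over a finite field has a linear
operator without eigenvectors. -/
theorem exists_linearMap_no_eigenvector (F V : Type) [Field F] [Finite F] [AddCommGroup V]
    [Module F V] [FiniteDimensional F V] (hV : 2 ≤ finrank F V) :
    ∃ T : V →ₗ[F] V, ∀ (a b : F) (w : V), a • w + b • T w = 0 → w = 0 ∨ (a = 0 ∧ b = 0) := by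
  obtain ⟨K, _, _, hK⟩ := exists_field_extension F (finrank F V) (by omega)
  have : FiniteDimensional F K := Module.finite_of_finrank_pos (by omega)
  let e : V ≃ₗ[F] K := LinearEquiv.ofFinrankEq V K hK.symm
  obtain ⟨β, hβ⟩ : ∃ β : K, ∀ a : F, algebraMap F K a ≠ β := by
    by_contra! h
    have : finrank F K ≤ 1 := finrank_le_one (1 : K) fun w => by
      obtain ⟨a, ha⟩ := h w
      exact ⟨a, by rw [← ha, Algebra.algebraMap_eq_smul_one]⟩
    omega
  refine ⟨e.symm.toLinearMap ∘ₗ LinearMap.mulLeft F β ∘ₗ e.toLinearMap, fun a b w h => ?_⟩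
  by_cases hw : w = 0
  · exact Or.inl hw
  right
  have h1 : (algebraMap F K a + algebraMap F K b * β) * e w = 0 := by
    have := congrArg e h
    simp only [map_add, map_smul, LinearMap.comp_apply, LinearEquiv.coe_coe,
      LinearMap.mulLeft_apply, LinearEquiv.apply_symm_apply, map_zero, Algebra.smul_def] at this
    rw [← this]
    ring
  have h2 : algebraMap F K a + algebraMap F K b * β = 0 :=
    (mul_eq_zero.1 h1).resolve_right (by simpa using hw)
  have hb : b = 0 := by
    by_contra hb
    have hb' : algebraMap F K b ≠ 0 := by simpa using hb
    refine hβ (-a / b) ?_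
    rw [map_div₀, map_neg, div_eq_iff hb']
    linear_combination -h2
  subst hb
  simpa using h2

/-- Linear rank-metric codes of minimum rank distance two attaining the Singleton bound. -/
theorem exists_rank_distance_two_code (F V : Type) [Field F] [Finite F] [AddCommGroup V]
    [Module F V] [FiniteDimensional F V] (hV : 4 ≤ finrank F V) :
    ∃ M : (Fin 3 → V) → ((Fin 4 → F) →ₗ[F] V), ∀ m m', m ≠ m' →
      finrank F (LinearMap.ker (M m - M m')) ≤ 2 := by
  obtain ⟨K, _, _, hK⟩ := exists_field_extension F (finrank F V) (by omega)
  have : FiniteDimensional F K := Module.finite_of_finrank_pos (by omega)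
  let e : V ≃ₗ[F] K := LinearEquiv.ofFinrankEq V K hK.symm
  let b : Basis (Fin (finrank F V)) F K := finBasisOfFinrankEq F K hK
  let β : Fin 4 → K := fun i => b (Fin.castLE hV i)
  have hβ : LinearIndependent F β :=
    b.linearIndependent.comp _ (Fin.castLE_injective hV)
  have hβ0 : β 0 ≠ 0 := hβ.ne_zero 0
  let v : (Fin 3 → V) → Fin 4 → K := fun m =>
    Fin.cons (-(β 0)⁻¹ * ∑ i, β i.succ * e (m i)) fun i => e (m i)
  have hv : ∀ m, ∑ i, β i * v m i = 0 := by
    intro m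
    rw [Fin.sum_univ_succ]
    simp only [v, Fin.cons_zero, Fin.cons_succ]
    field_simp
    ring
  refine ⟨fun m => e.symm.toLinearMap ∘ₗ Fintype.linearCombination F (v m), fun m m' hne => ?_⟩
  set D := e.symm.toLinearMap ∘ₗ Fintype.linearCombination F (v m) -
    e.symm.toLinearMap ∘ₗ Fintype.linearCombination F (v m') with hD
  have hDi : ∀ i, e (D (Pi.single i 1)) = v m i - v m' i := by
    intro i
    simp [hD]
  have hrank : 2 ≤ finrank F (LinearMap.range D) := by
    by_contra! hlt
    obtain ⟨w, hw⟩ := finrank_le_one_iff.1 (Nat.le_of_lt_succ hlt)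
    choose c hc using fun i => hw ⟨D (Pi.single i 1), LinearMap.mem_range_self _ _⟩
    have hc' : ∀ i, c i • e w = v m i - v m' i := by
      intro i
      rw [← hDi, ← map_smul, ← Submodule.coe_smul, hc]
    have hsum : (∑ i, c i • β i) * e w = 0 := by
      have h0 : ∑ i, β i * (v m i - v m' i) = 0 := by
        simp only [mul_sub, Finset.sum_sub_distrib, hv, sub_self]
      rw [← h0, Finset.sum_mul]
      refine Finset.sum_congr rfl fun i _ => ?_
      rw [← hc', mul_smul_comm, smul_mul_assoc]
    have hzero : ∀ i, v m i - v m' i = 0 := by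
      intro i
      rw [← hc']
      rcases mul_eq_zero.1 hsum with h | h
      · rw [Fintype.linearIndependent_iff.1 hβ c h i, zero_smul]
      · rw [h, smul_zero]
    refine hne (funext fun i => e.injective ?_)
    simpa [v, sub_eq_zero] using hzero i.succ
  have := LinearMap.finrank_range_add_finrank_ker D
  rw [finrank_fin_fun] at this
  omega

end Fields

section Construction

variable {F V V' : Type} [Field F] [AddCommGroup V] [Module F V] [AddCommGroup V'] [Module F V']

/-- The subspace `{(p, f p + l) | p ∈ P, l ∈ L}` of `V × V'`. -/
def graphSum (P : Submodule F V) (f : P →ₗ[F] V') (L : Submodule F V') : Submodule F (V × V') :=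
  LinearMap.range (LinearMap.prod (P.subtype ∘ₗ LinearMap.fst F P L)
    (f ∘ₗ LinearMap.fst F P L + L.subtype ∘ₗ LinearMap.snd F P L))

theorem mem_graphSum {P : Submodule F V} {f : P →ₗ[F] V'} {L : Submodule F V'} {x : V × V'} :
    x ∈ graphSum P f L ↔ ∃ h : x.1 ∈ P, x.2 - f ⟨x.1, h⟩ ∈ L := by
  constructor
  · rintro ⟨⟨p, l⟩, rfl⟩
    exact ⟨p.2, by simp⟩
  · rintro ⟨h, hl⟩
    exact ⟨(⟨x.1, h⟩, ⟨_, hl⟩), by ext <;> simp⟩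

theorem finrank_graphSum [FiniteDimensional F V] [FiniteDimensional F V']
    (P : Submodule F V) (f : P →ₗ[F] V') (L : Submodule F V') :
    finrank F (graphSum P f L) = finrank F P + finrank F L := by
  rw [graphSum, LinearMap.finrank_range_of_inj, finrank_prod]
  rw [injective_iff_map_eq_zero]
  rintro ⟨p, l⟩ h
  have hp : p = 0 := Subtype.ext (congrArg Prod.fst h)
  subst hp
  have hl : l = 0 := by
    have := congrArg Prod.snd h
    simpa using this
  rw [hl, Prod.mk_zero_zero]

theorem finrank_graphSum_inf_le [FiniteDimensional F V] [FiniteDimensional F V']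
    {P P' : Submodule F V} {f : P →ₗ[F] V'} {f' : P' →ₗ[F] V'} {L L' : Submodule F V'} :
    finrank F (graphSum P f L ⊓ graphSum P' f' L' : Submodule F (V × V')) ≤
      finrank F (P ⊓ P' : Submodule F V) + finrank F (L ⊓ L' : Submodule F V') := by
  have key : ∀ {P : Submodule F V} {f : P →ₗ[F] V'} {L : Submodule F V'} (x : V × V'),
      x ∈ graphSum P f L → x.1 = 0 → x.2 ∈ L := by
    intro P f L x hx h0
    obtain ⟨h, hl⟩ := mem_graphSum.1 hx
    have : (⟨x.1, h⟩ : P) = 0 := Subtype.ext h0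
    simpa [this] using hl
  refine finrank_le_of_fst_of_snd _ _ _ ?_ ?_
  · intro x hx
    exact ⟨(mem_graphSum.1 hx.1).1, (mem_graphSum.1 hx.2).1⟩
  · intro x hx h0
    exact ⟨key x hx.1 h0, key x hx.2 h0⟩

theorem finrank_graphSum_inf_same_le [FiniteDimensional F V] [FiniteDimensional F V']
    {P : Submodule F V} {f f' : P →ₗ[F] V'} {L : Submodule F V'} :
    finrank F (graphSum P f L ⊓ graphSum P f' L : Submodule F (V × V')) ≤
      finrank F (L.comap (f - f')) + finrank F L := by
  rw [LinearEquiv.finrank_eq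
    (Submodule.equivMapOfInjective P.subtype P.injective_subtype (L.comap (f - f')))]
  refine finrank_le_of_fst_of_snd _ _ _ ?_ ?_
  · intro x hx
    obtain ⟨h, hl⟩ := mem_graphSum.1 hx.1
    obtain ⟨_, hl'⟩ := mem_graphSum.1 hx.2
    refine ⟨⟨x.1, h⟩, ?_, rfl⟩
    have := L.sub_mem hl' hl
    simpa using this
  · intro x hx h0
    obtain ⟨h, hl⟩ := mem_graphSum.1 hx.1
    have : (⟨x.1, h⟩ : P) = 0 := Subtype.ext h0
    simpa [this] using hl

theorem exists_linearMap_family_modulo [Finite F] [FiniteDimensional F V]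
    [FiniteDimensional F V'] {P : Submodule F V} (hP : finrank F P = 2) {L : Submodule F V'}
    {k : ℕ} (hk : 2 ≤ k) (hL : finrank F L + k = finrank F V') :
    ∃ f : (Fin k → F) → (P →ₗ[F] V'), ∀ κ κ', κ ≠ κ' → L.comap (f κ - f κ') = ⊥ := by
  obtain ⟨T, hT⟩ := exists_linearMap_no_eigenvector F (Fin k → F) (by simpa using hk)
  obtain ⟨Q, hQ⟩ := Submodule.exists_isCompl L
  have hQk : finrank F Q = k := by
    have := Submodule.finrank_add_eq_of_isCompl hQ
    omega
  let g : (Fin k → F) ≃ₗ[F] Q := LinearEquiv.ofFinrankEq _ _ (by rw [finrank_fin_fun, hQk])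
  let e : P ≃ₗ[F] F × F := LinearEquiv.ofFinrankEq _ _ (by rw [hP]; simp)
  refine ⟨fun κ => Q.subtype ∘ₗ g.toLinearMap ∘ₗ
    (LinearMap.coprod (LinearMap.toSpanSingleton F _ κ) (LinearMap.toSpanSingleton F _ (T κ))) ∘ₗ
      e.toLinearMap, fun κ κ' hne => ?_⟩
  rw [eq_bot_iff]
  intro p hp
  have hp' : ((g ((e p).1 • (κ - κ') + (e p).2 • T (κ - κ')) : Q) : V') ∈ L := by
    rw [Submodule.mem_comap] at hp
    convert hp using 1
    simp only [LinearMap.sub_apply, LinearMap.comp_apply, LinearEquiv.coe_coe,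
      LinearMap.coprod_apply, LinearMap.toSpanSingleton_apply, Submodule.subtype_apply,
      ← Submodule.coe_sub, ← map_sub]
    congr 2
    rw [map_sub, smul_sub, smul_sub]
    abel
  have h0 := Submodule.disjoint_def.1 hQ.disjoint _ hp' (Subtype.prop _)
  rw [Submodule.coe_eq_zero, LinearEquiv.map_eq_zero_iff] at h0
  rcases hT _ _ _ h0 with h | ⟨h1, h2⟩
  · exact absurd (sub_eq_zero.1 h) hne
  · exact (e.map_eq_zero_iff).1 (Prod.ext h1 h2)

theorem exists_linearMap_family_ker [Finite F] [FiniteDimensional F V]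
    [FiniteDimensional F V'] (hV' : 4 ≤ finrank F V') {U : Submodule F V}
    (hU : finrank F U = 4) :
    ∃ f : (Fin 3 → V') → (U →ₗ[F] V'), ∀ m m', m ≠ m' →
      finrank F (LinearMap.ker (f m - f m')) ≤ 2 := by
  obtain ⟨M, hM⟩ := exists_rank_distance_two_code F V' hV'
  let e : U ≃ₗ[F] (Fin 4 → F) := LinearEquiv.ofFinrankEq _ _ (by rw [hU]; simp)
  refine ⟨fun m => M m ∘ₗ e.toLinearMap, fun m m' hne => ?_⟩
  rw [← LinearMap.sub_comp, LinearMap.ker_comp, ← LinearEquiv.symm_symm e,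
    ← Submodule.map_equiv_eq_comap_symm, LinearEquiv.finrank_map_eq]
  exact hM m m' hne

/-- Linkage of a code in `V` with a lifted rank-metric code, extended by a coset construction:
planes lying over a coloured family of lines of `V` and a coloured family of lines of `V'`. -/
theorem HasPlaneCode.prod [Fintype F] [FiniteDimensional F V] [FiniteDimensional F V']
    (hV' : finrank F V' = 7) {N : ℕ} (hN : HasPlaneCode F V N)
    {C I J : Type} [Fintype I] [Fintype J]
    (P : C → I → Submodule F V) (hP : ∀ c t, finrank F (P c t) = 2)
    (hPd : ∀ c t t', t ≠ t' → P c t ⊓ P c t' = ⊥)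
    (hPc : ∀ c c' t t', P c t = P c' t' → c = c')
    (L : J → Submodule F V') (hL : ∀ b, finrank F (L b) = 2) (hLi : Function.Injective L)
    (col : J → C) (hLd : ∀ b b', b ≠ b' → col b = col b' → L b ⊓ L b' = ⊥) :
    HasPlaneCode F (V × V') (N * Fintype.card F ^ 21 +
      Fintype.card J * Fintype.card I * Fintype.card F ^ 5) := by
  obtain ⟨U, hU, hUd⟩ := hN
  have : Finite V' := Module.finite_of_finite F
  have : Fintype V' := Fintype.ofFinite V'
  choose f hf using fun i => exists_linearMap_family_ker (V' := V') (by omega) (hU i)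
  choose g hg using fun c t b => exists_linearMap_family_modulo (hP c t) (L := L b)
    (k := 5) (by norm_num) (by rw [hL, hV'])
  refine HasPlaneCode.of_family (ι := (Fin N × (Fin 3 → V')) ⊕ (J × I × (Fin 5 → F))) ?_
    (Sum.elim (fun x => graphSum (U x.1) (f x.1 x.2) ⊥)
      fun x => graphSum (P (col x.1) x.2.1) (g (col x.1) x.2.1 x.1 x.2.2) (L x.1)) ?_ ?_
  · have : Fintype.card V' = Fintype.card F ^ 7 := by
      rw [Module.card_eq_pow_finrank (K := F), hV']
    simp only [Fintype.card_sum, Fintype.card_prod, Fintype.card_fin, Fintype.card_pi,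
      Finset.prod_const, Finset.card_univ, this]
    apply le_of_eq
    ring
  · rintro (x | x)
    · exact (finrank_graphSum _ _ _).trans (by rw [hU, finrank_bot])
    · exact (finrank_graphSum _ _ _).trans (by rw [hP, hL])
  · have mixed : ∀ (i : Fin N) (m : Fin 3 → V') (b : J) (t : I) (κ : Fin 5 → F),
        finrank F (graphSum (U i) (f i m) ⊥ ⊓
          graphSum (P (col b) t) (g (col b) t b κ) (L b) : Submodule F (V × V')) ≤ 2 := by
      intro i m b t κ
      refine finrank_graphSum_inf_le.trans ?_
      rw [bot_inf_eq, finrank_bot, add_zero, ← hP (col b) t]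
      exact Submodule.finrank_mono inf_le_right
    rintro (⟨i, m⟩ | ⟨b, t, κ⟩) (⟨i', m'⟩ | ⟨b', t', κ'⟩) hne
    · by_cases hi : i = i'
      · subst hi
        have hm : m ≠ m' := fun h => hne (by rw [h])
        refine finrank_graphSum_inf_same_le.trans ?_
        rw [finrank_bot, add_zero]
        exact hf i m m' hm
      · refine finrank_graphSum_inf_le.trans ?_
        rw [bot_inf_eq, finrank_bot, add_zero]
        exact hUd i i' hi
    · exact mixed i m b' t' κ'
    · rw [inf_comm]
      exact mixed i' m' b t κ
    · by_cases hb : b = b'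
      · subst hb
        by_cases ht : t = t'
        · subst ht
          have hκ : κ ≠ κ' := fun h => hne (by rw [h])
          refine finrank_graphSum_inf_same_le.trans ?_
          rw [hg _ _ _ _ _ hκ, finrank_bot, hL]
        · refine finrank_graphSum_inf_le.trans ?_
          rw [hPd _ _ _ ht, inf_idem, finrank_bot, hL]
      · by_cases hPP : P (col b) t = P (col b') t'
        · refine finrank_graphSum_inf_le.trans ?_
          rw [hLd b b' hb (hPc _ _ _ _ hPP), finrank_bot, add_zero, ← hP (col b) t]
          exact Submodule.finrank_mono inf_le_left
        · exact finrank_graphSum_inf_le.trans (add_le_add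
            (finrank_inf_le_one (hP _ _) (hP _ _) hPP)
            (finrank_inf_le_one (hL _) (hL _) (hLi.ne hb)))

end Construction

section Lines

variable {F V : Type} [Field F] [AddCommGroup V] [Module F V]

theorem finrank_span_pair_eq_two {x y : V} (h : ∀ a b : F, a • x + b • y = 0 → a = 0 ∧ b = 0) :
    finrank F (Submodule.span F {x, y}) = 2 := by
  have hli : LinearIndependent F ![x, y] := LinearIndependent.pair_iff.2 h
  have hcard := finrank_span_eq_card hli
  rwa [Matrix.range_cons_cons_empty, Fintype.card_fin] at hcard

theorem span_pair_inf_eq_bot {x y x' y' : V}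
    (h : ∀ a b a' b' : F, a • x + b • y = a' • x' + b' • y' → a = 0 ∧ b = 0) :
    Submodule.span F {x, y} ⊓ Submodule.span F {x', y'} = ⊥ := by
  rw [eq_bot_iff]
  rintro w ⟨hw, hw'⟩
  obtain ⟨a, b, rfl⟩ := Submodule.mem_span_pair.1 hw
  obtain ⟨a', b', hab⟩ := Submodule.mem_span_pair.1 hw'
  obtain ⟨rfl, rfl⟩ := h a b a' b' hab.symm
  simp

theorem exists_of_span_pair_eq {x y x' y' : V}
    (h : Submodule.span F {x, y} = Submodule.span F {x', y'}) :
    (∃ a b : F, a • x' + b • y' = x) ∧ ∃ a b : F, a • x' + b • y' = y := by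
  simp only [← Submodule.mem_span_pair, ← h]
  exact ⟨Submodule.subset_span (by simp), Submodule.subset_span (by simp)⟩

end Lines

section LargeField

/-- The lines `P c u` are spanned by `(1, 0, u)` and `(0, 1, c + T u)`. -/
theorem exists_lines_of_no_eigenvector {F W : Type} [Field F] [AddCommGroup W] [Module F W]
    (T : W →ₗ[F] W) (hT : ∀ (a b : F) (w : W), a • w + b • T w = 0 → w = 0 ∨ (a = 0 ∧ b = 0)) :
    ∃ P : W → W → Submodule F (F × F × W), (∀ c u, finrank F (P c u) = 2) ∧
      (∀ c u u', u ≠ u' → P c u ⊓ P c u' = ⊥) ∧ ∀ c c' u u', P c u = P c' u' → c = c' := by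
  refine ⟨fun c u => Submodule.span F {(1, 0, u), (0, 1, c + T u)}, fun c u => ?_,
    fun c u u' hne => ?_, fun c c' u u' h => ?_⟩
  · refine finrank_span_pair_eq_two fun a b h => ?_
    simp_all [Prod.ext_iff]
  · refine span_pair_inf_eq_bot fun a b a' b' h => ?_
    simp only [Prod.smul_mk, Prod.mk_add_mk, Prod.mk.injEq, smul_eq_mul, mul_one, mul_zero,
      add_zero, zero_add] at h
    obtain ⟨rfl, rfl, h⟩ := h
    refine (hT a b (u - u') ?_).resolve_left (sub_ne_zero.2 hne)
    rw [map_sub, smul_sub, smul_sub]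
    rw [smul_add, smul_add] at h
    rw [← sub_eq_zero] at h
    rw [← h]
    abel
  · obtain ⟨⟨a, b, h1⟩, a', b', h2⟩ := exists_of_span_pair_eq h
    simp only [Prod.smul_mk, Prod.mk_add_mk, Prod.mk.injEq, smul_eq_mul, mul_one, mul_zero,
      add_zero, zero_add] at h1 h2
    obtain ⟨rfl, rfl, h1⟩ := h1
    obtain ⟨rfl, rfl, h2⟩ := h2
    simp only [one_smul, zero_smul, add_zero, zero_add] at h1 h2
    subst h1
    exact (add_right_cancel h2).symm

/-- A properly coloured family of lines in dimension seven, with at most `q ^ 6` colours. -/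
theorem exists_coloured_lines_of_two_lt {F W : Type} [Field F] [Fintype F] [AddCommGroup W]
    [Module F W] [FiniteDimensional F W] (hF : 2 < Fintype.card F) (hW : finrank F W = 3) :
    ∃ (J : Type) (_ : Fintype J) (L : J → Submodule F (F × F × F × F × W))
      (col : J → F × F × F × W),
      Fintype.card J = Fintype.card F ^ 10 + Fintype.card F ^ 9 + Fintype.card F ^ 8 ∧
      (∀ b, finrank F (L b) = 2) ∧ Function.Injective L ∧
      ∀ b b', b ≠ b' → col b = col b' → L b ⊓ L b' = ⊥ := by
  obtain ⟨g0, g1, g2, h01, h02, h12⟩ := Fintype.two_lt_card_iff.1 hF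
  have : Finite W := Module.finite_of_finite F
  have : Fintype W := Fintype.ofFinite W
  have hWcard : Fintype.card W = Fintype.card F ^ 3 := by
    rw [Module.card_eq_pow_finrank (K := F), hW]
  obtain ⟨T5, hT5⟩ := exists_linearMap_no_eigenvector F (F × F × W) (by simp [hW])
  obtain ⟨T4, hT4⟩ := exists_linearMap_no_eigenvector F (F × W) (by simp [hW])
  obtain ⟨T3, hT3⟩ := exists_linearMap_no_eigenvector F W (by simp [hW])
  have key : ∀ {U : Type} [AddCommGroup U] [Module F U] (T : U →ₗ[F] U) (c u u' : U) (a b : F),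
      (∀ (a b : F) (w : U), a • w + b • T w = 0 → w = 0 ∨ (a = 0 ∧ b = 0)) → u ≠ u' →
      a • u + b • (c + T u) = a • u' + b • (c + T u') → a = 0 ∧ b = 0 := by
    intro U _ _ T c u u' a b hT hne h
    refine (hT a b (u - u') ?_).resolve_left (sub_ne_zero.2 hne)
    rw [map_sub, smul_sub, smul_sub]
    rw [smul_add, smul_add, ← sub_eq_zero] at h
    rw [← h]
    abel
  let L : (((F × F × W) × (F × F × W)) ⊕ (F × (F × W) × (F × W)) ⊕ (F × F × W × W)) →
      Submodule F (F × F × F × F × W) :=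
    Sum.elim (fun x => Submodule.span F {(1, 0, x.1), (0, 1, x.2 + T5 x.1)})
      (Sum.elim (fun x => Submodule.span F {(1, x.1, 0, x.2.1), (0, 0, 1, x.2.2 + T4 x.2.1)})
        (fun x => Submodule.span F
          {(1, x.1, x.2.1, 0, x.2.2.1), (0, 0, 0, 1, x.2.2.2 + T3 x.2.2.1)}))
  let col : (((F × F × W) × (F × F × W)) ⊕ (F × (F × W) × (F × W)) ⊕ (F × F × W × W)) →
      F × F × F × W :=
    Sum.elim (fun x => (g0, x.2))
      (Sum.elim (fun x => (g1, x.1, x.2.2)) (fun x => (g2, x.1, x.2.1, x.2.2.2)))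
  refine ⟨_, inferInstance, L, col, ?_, ?_, ?_, ?_⟩
  · simp only [Fintype.card_sum, Fintype.card_prod, hWcard]
    ring
  · rintro (x | x | x) <;> refine finrank_span_pair_eq_two fun a b h => ?_ <;>
      simp only [Prod.smul_mk, Prod.mk_add_mk, Prod.mk_eq_zero, smul_eq_mul, mul_one, mul_zero,
        add_zero, zero_add] at h <;>
      tauto
  · rintro (⟨u, c⟩ | ⟨s, u, c⟩ | ⟨s, t, u, c⟩) (⟨u', c'⟩ | ⟨s', u', c'⟩ | ⟨s', t', u', c'⟩) h <;>
      obtain ⟨⟨a, b, h1⟩, a', b', h2⟩ := exists_of_span_pair_eq h <;>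
      simp only [Prod.smul_mk, Prod.mk_add_mk, Prod.mk.injEq, smul_eq_mul, mul_one, mul_zero,
        add_zero, zero_add] at h1 h2
    · obtain ⟨rfl, rfl, h1⟩ := h1
      obtain ⟨rfl, rfl, h2⟩ := h2
      simp only [one_smul, zero_smul, add_zero, zero_add] at h1 h2
      subst h1
      rw [add_right_cancel h2]
    · obtain ⟨rfl, h2, -⟩ := h2
      simp at h2
    · obtain ⟨rfl, h2, -⟩ := h2
      simp at h2
    · obtain ⟨rfl, rfl, h2⟩ := h2
      simp [Prod.ext_iff] at h2
    · obtain ⟨rfl, rfl, rfl, h1⟩ := h1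
      obtain ⟨rfl, -, rfl, h2⟩ := h2
      simp only [one_smul, zero_smul, add_zero, zero_add, one_mul] at h1 h2 ⊢
      subst h1
      rw [add_right_cancel h2]
    · obtain ⟨rfl, -, h2, -⟩ := h2
      simp at h2
    · obtain ⟨rfl, rfl, h2⟩ := h2
      simp [Prod.ext_iff] at h2
    · obtain ⟨rfl, -, rfl, h2⟩ := h2
      simp [Prod.ext_iff] at h2
    · obtain ⟨rfl, rfl, rfl, rfl, h1⟩ := h1
      obtain ⟨rfl, -, -, rfl, h2⟩ := h2
      simp only [one_smul, zero_smul, add_zero, zero_add, one_mul] at h1 h2 ⊢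
      subst h1
      rw [add_right_cancel h2]
  · rintro (⟨u, c⟩ | ⟨s, u, c⟩ | ⟨s, t, u, c⟩) (⟨u', c'⟩ | ⟨s', u', c'⟩ | ⟨s', t', u', c'⟩) hne h <;>
      simp only [col, Sum.elim_inl, Sum.elim_inr, Prod.mk.injEq] at h
    · obtain ⟨-, rfl⟩ := h
      refine span_pair_inf_eq_bot fun a b a' b' h => ?_
      simp only [Prod.smul_mk, Prod.mk_add_mk, Prod.mk.injEq, smul_eq_mul, mul_one, mul_zero,
        add_zero, zero_add] at h
      obtain ⟨rfl, rfl, h⟩ := h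
      exact key T5 c u u' a b hT5 (fun h => hne (by rw [h])) h
    · exact absurd h.1 h01
    · exact absurd h.1 h02
    · exact absurd h.1.symm h01
    · obtain ⟨-, rfl, rfl⟩ := h
      refine span_pair_inf_eq_bot fun a b a' b' h => ?_
      simp only [Prod.smul_mk, Prod.mk_add_mk, Prod.mk.injEq, smul_eq_mul, mul_one, mul_zero,
        add_zero, zero_add] at h
      obtain ⟨rfl, -, rfl, h⟩ := h
      exact key T4 c u u' a b hT4 (fun h => hne (by rw [h])) h
    · exact absurd h.1 h12
    · exact absurd h.1.symm h02
    · exact absurd h.1.symm h12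
    · obtain ⟨-, rfl, rfl, rfl⟩ := h
      refine span_pair_inf_eq_bot fun a b a' b' h => ?_
      simp only [Prod.smul_mk, Prod.mk_add_mk, Prod.mk.injEq, smul_eq_mul, mul_one, mul_zero,
        add_zero, zero_add] at h
      obtain ⟨rfl, -, -, rfl, h⟩ := h
      exact key T3 c u u' a b hT3 (fun h => hne (by rw [h])) h

end LargeField

section TwoElements

variable {F V K : Type} [Field F] [AddCommGroup V] [Module F V]

theorem exists_mem_ne_of_finrank_eq_two {L : Submodule F V} (hL : finrank F L = 2) (x : V) :
    ∃ y ∈ L, y ≠ 0 ∧ y ≠ x := by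
  by_contra! h
  have : L ≤ Submodule.span F {x} := by
    intro y hy
    by_cases hy0 : y = 0
    · rw [hy0]
      exact zero_mem _
    · rw [h y hy hy0]
      exact Submodule.mem_span_singleton_self x
  have h1 := (Submodule.finrank_mono this).trans (finrank_span_le_card {x})
  rw [Set.toFinset_singleton, Finset.card_singleton] at h1
  omega

variable [Fintype F]

theorem eq_zero_or_one_of_card_eq_two (hF : Fintype.card F = 2) (a : F) : a = 0 ∨ a = 1 := by
  by_contra! h
  have := Fintype.two_lt_card_iff.2 ⟨a, 0, 1, h.1, h.2, zero_ne_one⟩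
  omega

theorem mem_span_pair_of_card_eq_two (hF : Fintype.card F = 2) {x y w : V}
    (hw : w ∈ Submodule.span F {x, y}) : w = 0 ∨ w = x ∨ w = y ∨ w = x + y := by
  obtain ⟨a, b, rfl⟩ := Submodule.mem_span_pair.1 hw
  rcases eq_zero_or_one_of_card_eq_two hF a with rfl | rfl <;>
    rcases eq_zero_or_one_of_card_eq_two hF b with rfl | rfl <;> simp

theorem one_add_one_eq_zero_of_card_eq_two (hF : Fintype.card F = 2) : (1 : F) + 1 = 0 := by
  rcases eq_zero_or_one_of_card_eq_two hF (1 + 1) with h | h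
  · exact h
  · exact absurd (add_eq_left.1 h) one_ne_zero

theorem finrank_span_pair_of_card_eq_two (hF : Fintype.card F = 2) {x y : V} (hx : x ≠ 0)
    (hy : y ≠ 0) (hxy : x ≠ y) : finrank F (Submodule.span F {x, y}) = 2 := by
  have hneg : ∀ v : V, v + v = 0 := fun v => by
    rw [← one_smul F v, ← add_smul, one_add_one_eq_zero_of_card_eq_two hF, zero_smul]
  refine finrank_span_pair_eq_two fun a b h => ?_
  rcases eq_zero_or_one_of_card_eq_two hF a with rfl | rfl <;>
    rcases eq_zero_or_one_of_card_eq_two hF b with rfl | rfl <;> simp at h ⊢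
  · exact hy h
  · exact hx h
  · exact hxy (by rw [eq_neg_of_add_eq_zero_left h, neg_eq_of_add_eq_zero_left (hneg y)])

theorem eq_span_pair_of_card_eq_two [FiniteDimensional F V] (hF : Fintype.card F = 2)
    {L : Submodule F V} (hL : finrank F L = 2) {x y : V} (hxL : x ∈ L) (hyL : y ∈ L)
    (hx : x ≠ 0) (hy : y ≠ 0) (hxy : x ≠ y) : Submodule.span F {x, y} = L := by
  refine Submodule.eq_of_le_of_finrank_eq ?_ ?_
  · rw [Submodule.span_le]
    rintro _ (rfl | rfl)
    · exact hxL
    · exact hyL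
  · rw [hL, finrank_span_pair_of_card_eq_two hF hx hy hxy]

variable [Field K] [Algebra F K]

theorem two_eq_zero_of_card_eq_two (hF : Fintype.card F = 2) : (2 : K) = 0 := by
  have := congrArg (algebraMap F K) (one_add_one_eq_zero_of_card_eq_two hF)
  rw [map_add, map_one, map_zero] at this
  rw [← one_add_one_eq_two, this]

/-- The Baker–Preparata colour `x y (x + y)` does not depend on the chosen points of a line. -/
theorem exists_colour_of_card_eq_two [FiniteDimensional F K] (hF : Fintype.card F = 2)
    {L : Submodule F K} (hL : finrank F L = 2) :
    ∃ c : K, c ≠ 0 ∧ ∀ x ∈ L, ∀ y ∈ L, x ≠ 0 → y ≠ 0 → x ≠ y → x * y * (x + y) = c := by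
  have h2 : (2 : K) = 0 := two_eq_zero_of_card_eq_two hF
  obtain ⟨a, haL, ha, -⟩ := exists_mem_ne_of_finrank_eq_two hL 0
  obtain ⟨b, hbL, hb, hba⟩ := exists_mem_ne_of_finrank_eq_two hL a
  have hspan := eq_span_pair_of_card_eq_two hF hL haL hbL ha hb hba.symm
  refine ⟨a * b * (a + b), mul_ne_zero (mul_ne_zero ha hb) fun h => hba ?_, ?_⟩
  · linear_combination h - a * h2
  · intro x hx y hy hx0 hy0 hxy
    rw [← hspan] at hx hy
    rcases mem_span_pair_of_card_eq_two hF hx with hx | hx | hx | hx <;>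
      rcases mem_span_pair_of_card_eq_two hF hy with hy | hy | hy | hy <;>
      try first
      | exact absurd hx hx0
      | exact absurd hy hy0
      | exact absurd (hx.trans hy.symm) hxy
      | rw [hx, hy, mul_comm b a, add_comm b a]
    all_goals rw [hx, hy]
    · linear_combination (a ^ 2 * (a + b)) * h2
    · linear_combination (b ^ 2 * (a + b)) * h2
    · linear_combination (a ^ 2 * (a + b)) * h2
    · linear_combination (b ^ 2 * (a + b)) * h2

theorem disjoint_of_colour_eq [FiniteDimensional F K] (hF : Fintype.card F = 2)
    {L L' : Submodule F K} (hL : finrank F L = 2) (hL' : finrank F L' = 2) (hne : L ≠ L') {c : K}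
    (hc : ∀ x ∈ L, ∀ y ∈ L, x ≠ 0 → y ≠ 0 → x ≠ y → x * y * (x + y) = c)
    (hc' : ∀ x ∈ L', ∀ y ∈ L', x ≠ 0 → y ≠ 0 → x ≠ y → x * y * (x + y) = c) :
    L ⊓ L' = ⊥ := by
  rw [eq_bot_iff]
  rintro z ⟨hz, hz'⟩
  by_contra hz0
  have hz0 : z ≠ 0 := hz0
  obtain ⟨w, hw, hw0, hwz⟩ := exists_mem_ne_of_finrank_eq_two hL z
  obtain ⟨w', hw', hw0', hwz'⟩ := exists_mem_ne_of_finrank_eq_two hL' z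
  have h2 : (2 : K) = 0 := two_eq_zero_of_card_eq_two hF
  have h1 := (hc z hz w hw hz0 hw0 hwz.symm).trans (hc' z hz' w' hw' hz0 hw0' hwz'.symm).symm
  have h3 : z * ((w - w') * (w + w' + z)) = 0 := by linear_combination h1
  have hmem : w ∈ L' := by
    rcases mul_eq_zero.1 ((mul_eq_zero.1 h3).resolve_left hz0) with h | h
    · rwa [sub_eq_zero.1 h]
    · have : w = w' + z := by linear_combination h - (w' + z) * h2
      rw [this]
      exact L'.add_mem hw' hz'
  exact hne ((eq_span_pair_of_card_eq_two hF hL hz hw hz0 hw0 hwz.symm).symm.trans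
    (eq_span_pair_of_card_eq_two hF hL' hz' hmem hz0 hw0 hwz.symm))

theorem card_lines_of_card_eq_two [Fintype K] [FiniteDimensional F K]
    [Fintype {L : Submodule F K // finrank F L = 2}] (hF : Fintype.card F = 2)
    (hK : Fintype.card K = 128) :
    2667 ≤ Fintype.card {L : Submodule F K // finrank F L = 2} := by
  classical
  let s : Finset (K × K) := ({0}ᶜ : Finset K).offDiag
  have hs : s.card = 16002 := by
    rw [Finset.offDiag_card, Finset.card_compl, hK, Finset.card_singleton]
  have hmem : ∀ p : K × K, p ∈ s → p.1 ≠ 0 ∧ p.2 ≠ 0 ∧ p.1 ≠ p.2 := by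
    intro p hp
    simpa [s, Finset.mem_offDiag] using hp
  have hle := Finset.card_le_mul_card_image (f := fun p : K × K => Submodule.span F {p.1, p.2})
    s 6 ?_
  · have himg : (s.image fun p : K × K => Submodule.span F {p.1, p.2}).card ≤
        Fintype.card {L : Submodule F K // finrank F L = 2} := by
      rw [← Finset.card_univ, ← Finset.card_map (Function.Embedding.subtype _)]
      refine Finset.card_le_card fun L hL => ?_
      obtain ⟨p, hp, rfl⟩ := Finset.mem_image.1 hL
      obtain ⟨h1, h2, h3⟩ := hmem p hp
      simpa using finrank_span_pair_of_card_eq_two hF h1 h2 h3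
    omega
  · intro L hL
    obtain ⟨⟨a, b⟩, hp, rfl⟩ := Finset.mem_image.1 hL
    have hsub : (s.filter fun p => Submodule.span F {p.1, p.2} = Submodule.span F {a, b}) ⊆
        ({a, b, a + b} : Finset K).offDiag := by
      rintro ⟨x, y⟩ hxy
      obtain ⟨hxys, hspan⟩ := Finset.mem_filter.1 hxy
      obtain ⟨hx, hy, hne⟩ := hmem _ hxys
      have hx' : x ∈ Submodule.span F {a, b} := hspan ▸ Submodule.subset_span (by simp)
      have hy' : y ∈ Submodule.span F {a, b} := hspan ▸ Submodule.subset_span (by simp)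
      have h1 := (mem_span_pair_of_card_eq_two hF hx').resolve_left hx
      have h2 := (mem_span_pair_of_card_eq_two hF hy').resolve_left hy
      rw [Finset.mem_offDiag]
      exact ⟨by simpa using h1, by simpa using h2, hne⟩
    refine (Finset.card_le_card hsub).trans ?_
    rw [Finset.offDiag_card]
    have h3 : ({a, b, a + b} : Finset K).card ≤ 3 := Finset.card_le_three
    generalize ({a, b, a + b} : Finset K).card = k at h3
    interval_cases k <;> norm_num

theorem cube_bijective_of_card [Fintype K] (hK : Fintype.card K = 128) :
    Function.Bijective fun x : K => x ^ 3 := by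
  rw [← Finite.injective_iff_bijective]
  intro x y h
  have h1 : ∀ z : K, z ^ 128 = z := fun z => hK ▸ FiniteField.pow_card z
  have h3 : x ^ 3 = y ^ 3 := h
  have h255 : ∀ z : K, z = (z ^ 3) ^ 85 := fun z => by
    calc z = z ^ 128 := (h1 z).symm
      _ = z ^ 128 * z ^ 127 := by rw [h1, ← pow_succ', h1]
      _ = (z ^ 3) ^ 85 := by ring
  rw [h255 x, h3, ← h255]

/-- For every nonzero colour `c` there are 64 pairwise disjoint lines of `K × F` spanned by
points `(x, 1)` and `(y, 1)` with `x ^ 3 + y ^ 3 = c`. -/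
theorem exists_lines_of_cube_sum [Fintype K] [FiniteDimensional F K] (hF : Fintype.card F = 2)
    (hK : Fintype.card K = 128) {c : K} (hc : c ≠ 0) :
    ∃ P : Fin 64 → Submodule F (K × F), (∀ t, finrank F (P t) = 2) ∧
      (∀ t t', t ≠ t' → P t ⊓ P t' = ⊥) ∧
      ∀ t, ∃ x y : K, x ≠ y ∧ x ^ 3 + y ^ 3 = c ∧ P t = Submodule.span F {(x, 1), (y, 1)} := by
  classical
  have h2 : (2 : K) = 0 := two_eq_zero_of_card_eq_two hF
  have h1 : (1 : F) + 1 = 0 := one_add_one_eq_zero_of_card_eq_two hF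
  choose σ hσ using fun x : K => (cube_bijective_of_card hK).2 (c - x ^ 3)
  have hcube : ∀ {x y : K}, x ^ 3 = y ^ 3 → x = y := fun h => (cube_bijective_of_card hK).1 h
  have hσ : ∀ x, x ^ 3 + σ x ^ 3 = c := fun x => by linear_combination hσ x
  have hσσ : ∀ x, σ (σ x) = x := fun x => hcube (by linear_combination hσ (σ x) - hσ x)
  have hσne : ∀ x, x ≠ σ x := fun x h => hc (by
    rw [← hσ x, ← h]
    linear_combination x ^ 3 * h2)
  let ℓ : K → Submodule F (K × F) := fun x => Submodule.span F {(x, 1), (σ x, 1)}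
  have hℓσ : ∀ x, ℓ (σ x) = ℓ x := fun x => by
    simp only [ℓ, hσσ, Set.pair_comm]
  have hmem : ∀ {x : K} {w : K × F}, w ∈ ℓ x →
      w = 0 ∨ w = (x, 1) ∨ w = (σ x, 1) ∨ w = (x + σ x, 0) := by
    intro x w hw
    simpa [h1] using mem_span_pair_of_card_eq_two hF hw
  have hpoint : ∀ {x w : K}, (w, (1 : F)) ∈ ℓ x → w = x ∨ w = σ x := by
    intro x w hw
    simpa using hmem hw
  have hself : ∀ x, (x, (1 : F)) ∈ ℓ x := fun x => Submodule.subset_span (by simp)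
  have hrank : ∀ x, finrank F (ℓ x) = 2 := fun x =>
    finrank_span_pair_of_card_eq_two hF (by simp) (by simp) (by simpa using hσne x)
  have hpoint_eq : ∀ {x x' : K}, x' = x ∨ x' = σ x → ℓ x' = ℓ x := by
    rintro x x' (rfl | rfl)
    · rfl
    · exact hℓσ x
  have hdisj : ∀ x x', ℓ x ≠ ℓ x' → ℓ x ⊓ ℓ x' = ⊥ := by
    intro x x' hne
    rw [eq_bot_iff]
    rintro w ⟨hw, hw'⟩
    by_contra hw0
    have hw0 : w ≠ 0 := hw0
    have hnot : ∀ v : K, (v, (1 : F)) ∈ ℓ x → (v, (1 : F)) ∈ ℓ x' → False := fun v hv hv' =>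
      hne ((hpoint_eq (hpoint hv)).symm.trans (hpoint_eq (hpoint hv')))
    rcases (hmem hw).resolve_left hw0 with rfl | rfl | rfl
    · exact hnot _ hw hw'
    · exact hnot _ hw hw'
    · have hsum : x + σ x = x' + σ x' := by simpa [hw0] using hmem hw'
      have hd : x + σ x ≠ 0 := fun h => hσne x (by linear_combination h - σ x * h2)
      have hprod : (x + σ x) * (x * σ x - x' * σ x') = 0 := by
        linear_combination ((x + σ x) ^ 2 + (x + σ x) * (x' + σ x') + (x' + σ x') ^ 2 -
          3 * (x' * σ x')) * hsum - hσ x + hσ x' - (x + σ x) * (x * σ x - x' * σ x') * h2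
      have hprod := (mul_eq_zero.1 hprod).resolve_left hd
      have hroot : (x' - x) * (x' - σ x) = 0 := by
        linear_combination hprod - x' * hsum
      refine hne (hpoint_eq ?_).symm
      simpa [sub_eq_zero] using hroot
  have hcard : 64 ≤ (Finset.univ.image ℓ).card := by
    have := Finset.card_le_mul_card_image (f := ℓ) Finset.univ 2 fun L hL => ?_
    · rw [Finset.card_univ, hK] at this
      omega
    · obtain ⟨x, -, rfl⟩ := Finset.mem_image.1 hL
      refine (Finset.card_le_card (t := {x, σ x}) fun y hy => ?_).trans Finset.card_le_two
      have : ℓ y = ℓ x := (Finset.mem_filter.1 hy).2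
      simpa using hpoint (this ▸ hself y)
  obtain ⟨e⟩ : Nonempty (Fin 64 ↪ Finset.univ.image ℓ) :=
    Function.Embedding.nonempty_of_card_le (by rwa [Fintype.card_fin, Fintype.card_coe])
  have he : ∀ t, ∃ x, ℓ x = e t := fun t => by
    obtain ⟨x, -, hx⟩ := Finset.mem_image.1 (e t).2
    exact ⟨x, hx⟩
  refine ⟨fun t => e t, fun t => ?_, fun t t' hne => ?_, fun t => ?_⟩
  · obtain ⟨x, hx⟩ := he t
    change finrank F (e t : Submodule F (K × F)) = 2
    rw [← hx, hrank]
  · have hne' : (e t : Submodule F (K × F)) ≠ e t' := fun h => hne (e.injective (Subtype.ext h))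
    obtain ⟨x, hx⟩ := he t
    obtain ⟨x', hx'⟩ := he t'
    simp only [← hx, ← hx'] at hne' ⊢
    exact hdisj x x' hne'
  · obtain ⟨x, hx⟩ := he t
    exact ⟨x, σ x, hσne x, hσ x, hx.symm⟩

end TwoElements

section Main

theorem hasPlaneCode_of_two_lt {F : Type} [Field F] [Fintype F] (hF : 2 < Fintype.card F) {N : ℕ}
    (hN : HasPlaneCode F (Fin 8 → F) N) :
    HasPlaneCode F (Fin 15 → F) (N * Fintype.card F ^ 21 +
      (Fintype.card F ^ 21 + Fintype.card F ^ 20 + Fintype.card F ^ 19)) := by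
  obtain ⟨T, hT⟩ := exists_linearMap_no_eigenvector F (F × F × F × (Fin 3 → F)) (by simp)
  obtain ⟨P, hP, hPd, hPc⟩ := exists_lines_of_no_eigenvector T hT
  obtain ⟨J, _, L, col, hJ, hL, hLi, hLd⟩ :=
    exists_coloured_lines_of_two_lt (W := Fin 3 → F) hF (by simp)
  have h := HasPlaneCode.prod (by simp) (hN.map (LinearEquiv.ofFinrankEq _ _ (by simp)))
    P hP hPd hPc L hL hLi col hLd
  have hcard : Fintype.card J * Fintype.card (F × F × F × (Fin 3 → F)) * Fintype.card F ^ 5 =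
      Fintype.card F ^ 21 + Fintype.card F ^ 20 + Fintype.card F ^ 19 := by
    rw [hJ]
    simp only [Fintype.card_prod, Fintype.card_pi, Finset.prod_const, Finset.card_univ,
      Fintype.card_fin]
    ring
  rw [hcard] at h
  exact h.map (LinearEquiv.ofFinrankEq _ _ (by simp))

theorem hasPlaneCode_of_card_eq_two {F : Type} [Field F] [Fintype F] (hF : Fintype.card F = 2)
    {N : ℕ} (hN : HasPlaneCode F (Fin 8 → F) N) :
    HasPlaneCode F (Fin 15 → F) (N * Fintype.card F ^ 21 + 2667 * 64 * Fintype.card F ^ 5) := by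
  obtain ⟨K, _, _, hK⟩ := exists_field_extension F 7 (by norm_num)
  have : FiniteDimensional F K := Module.finite_of_finrank_pos (by omega)
  have : Finite K := Module.finite_of_finite F
  have : Fintype K := Fintype.ofFinite K
  have hKcard : Fintype.card K = 128 := by
    rw [Module.card_eq_pow_finrank (K := F), hF, hK]
    norm_num
  have : Fintype {L : Submodule F K // finrank F L = 2} := Fintype.ofFinite _
  obtain ⟨e⟩ : Nonempty (Fin 2667 ↪ {L : Submodule F K // finrank F L = 2}) :=
    Function.Embedding.nonempty_of_card_le
      (by simpa only [Fintype.card_fin] using card_lines_of_card_eq_two hF hKcard)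
  choose P hP hPd hPc using fun c : {c : K // c ≠ 0} => exists_lines_of_cube_sum hF hKcard c.2
  choose col hcol0 hcol using fun b => exists_colour_of_card_eq_two hF (e b).2
  have hunique : ∀ c c' t t', P c t = P c' t' → c = c' := by
    intro c c' t t' h
    obtain ⟨x, y, hxy, hc, hPx⟩ := hPc c t
    obtain ⟨x', y', -, hc', hPx'⟩ := hPc c' t'
    rw [hPx, hPx'] at h
    have hmem : ∀ w : K, (w, (1 : F)) ∈ Submodule.span F {(x, (1 : F)), (y, 1)} →
        w = x' ∨ w = y' := by
      intro w hw
      rw [h] at hw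
      have := mem_span_pair_of_card_eq_two hF hw
      simpa [one_add_one_eq_zero_of_card_eq_two hF] using this
    refine Subtype.ext ?_
    rw [← hc, ← hc']
    rcases hmem x (Submodule.subset_span (by simp)) with rfl | rfl <;>
      rcases hmem y (Submodule.subset_span (by simp)) with rfl | rfl
    · exact absurd rfl hxy
    · rfl
    · exact add_comm _ _
    · exact absurd rfl hxy
  have h := HasPlaneCode.prod hK (hN.map (LinearEquiv.ofFinrankEq _ (K × F) (by simp [hK])))
    P hP hPd hunique (fun b => (e b).1) (fun b => (e b).2)
    (Subtype.val_injective.comp e.injective) (fun b => ⟨col b, hcol0 b⟩) fun b b' hne hbb => by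
      have hbb : col b = col b' := congrArg Subtype.val hbb
      refine disjoint_of_colour_eq hF (e b).2 (e b').2
        (fun h => hne (e.injective (Subtype.ext h))) (hcol b) ?_
      rw [hbb]
      exact hcol b'
  simp only [Fintype.card_fin] at h
  exact h.map (LinearEquiv.ofFinrankEq _ _ (by simp [hK]))

theorem HasPlaneCode.mono {F V : Type*} [Field F] [AddCommGroup V] [Module F V] {M N : ℕ}
    (hMN : M ≤ N) (h : HasPlaneCode F V N) : HasPlaneCode F V M := by
  obtain ⟨f, hf, hd⟩ := h
  exact .of_family (by simpa using hMN) f hf hd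

theorem target_le_of_two_lt {q : ℕ} (hq : 2 < q) :
    q ^ 21 + 2 * q ^ 19 + 3 * q ^ 18 + 5 * q ^ 17 + q ^ 16 + 4 * q ^ 15 + 6 * q ^ 14 + 11 * q ^ 13 + 10 * q ^ 12 + 12 * q ^ 11 + 9 * q ^ 10 + 8 * q ^ 9 + 4 * q ^ 8 + 3 * q ^ 7 + 2 * q ^ 6 + q ^ 5 + q ^ 4 + q ^ 3 + q ^ 2 + 2 * q + 1 ≤
      q ^ 21 + q ^ 20 + q ^ 19 := by
  obtain ⟨r, rfl⟩ := Nat.exists_eq_add_of_lt hq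
  ring_nf
  gcongr <;> norm_num

end Main

theorem statement14 (q N : ℕ) (hq : IsPrimePow q)
    (F : Type) [Field F] [Fintype F] (hcard : Fintype.card F = q)
    (h : ∃ S : Set (Submodule F (Fin 8 → F)), S.ncard = N ∧
      (∀ X ∈ S, Module.finrank F ↥X = 4) ∧
      (∀ X ∈ S, ∀ Y ∈ S, X ≠ Y → 4 ≤ subspaceDist X Y)) :
    ∃ S : Set (Submodule F (Fin 15 → F)),
      S.ncard = N * q ^ 21 + (q ^ 21 + 2 * q ^ 19 + 3 * q ^ 18 + 5 * q ^ 17 + q ^ 16 + 4 * q ^ 15 + 6 * q ^ 14 + 11 * q ^ 13 + 10 * q ^ 12 + 12 * q ^ 11 + 9 * q ^ 10 + 8 * q ^ 9 + 4 * q ^ 8 + 3 * q ^ 7 + 2 * q ^ 6 + q ^ 5 + q ^ 4 + q ^ 3 + q ^ 2 + 2 * q + 1) ∧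
      (∀ X ∈ S, Module.finrank F ↥X = 4) ∧
      (∀ X ∈ S, ∀ Y ∈ S, X ≠ Y → 4 ≤ subspaceDist X Y) := by
  rw [← hasPlaneCode_iff] at h ⊢
  subst hcard
  rcases Nat.lt_or_ge 2 (Fintype.card F) with hF | hF
  · exact (hasPlaneCode_of_two_lt hF h).mono (Nat.add_le_add_left (target_le_of_two_lt hF) _)
  · have hF2 : Fintype.card F = 2 := le_antisymm hF hq.two_le
    refine (hasPlaneCode_of_card_eq_two hF2 h).mono (Nat.add_le_add_left ?_ _)
    rw [hF2]
    norm_num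
end

section
/- There exists a set of 80587907742 four-dimensional subspaces of F_2^{16} whose pairwise subspace distance is at least 4; that is, A_2(16,4,4) ≥ 80587907742. -/
open Module in
/-- Elements `eᵢ` of a field extension that satisfy a linear relation with linearly independent
coefficients are either all zero or span a space of dimension at least two. -/
theorem two_le_finrank_span_of_relation {F E ι : Type*} [Field F] [Field E] [Algebra F E]
    [FiniteDimensional F E] [Fintype ι] {a e : ι → E} (ha : LinearIndependent F a)
    (he : e ≠ 0) (h : ∑ i, a i * e i = 0) :
    2 ≤ finrank F ↥(Submodule.span F (Set.range e)) := by
  by_contra hlt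
  obtain ⟨v, hv⟩ := finrank_le_one_iff.mp (Nat.le_of_lt_succ (not_le.mp hlt))
  have hmem (i : ι) : ∃ c : F, c • (v : E) = e i := by
    obtain ⟨c, hc⟩ := hv ⟨e i, Submodule.subset_span ⟨i, rfl⟩⟩
    exact ⟨c, congrArg Subtype.val hc⟩
  choose u hu using hmem
  have hprod : (∑ i, u i • a i) * (v : E) = 0 := by
    rw [Finset.sum_mul, ← h]
    refine Finset.sum_congr rfl fun i _ => ?_
    rw [← hu i, smul_mul_assoc, mul_smul_comm]
  apply he
  funext i
  rcases mul_eq_zero.mp hprod with h0 | h0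
  · rw [← hu i, Fintype.linearIndependent_iff.mp ha u h0 i, zero_smul, Pi.zero_apply]
  · rw [← hu i, h0, smul_zero, Pi.zero_apply]

open Module in
/-- The vectors `Fin k → E` parametrize linear maps `V → W` up to their values on `K` modulo `L`;
on the kernel of the syndrome map `s`, nonzero parameters give maps that have rank at least two as
maps from `K` to `W ⧸ L`. -/
theorem exists_syndrome {F E V W : Type*} [Field F] [Field E] [Algebra F E]
    [FiniteDimensional F E] [AddCommGroup V] [Module F V] [FiniteDimensional F V]
    [AddCommGroup W] [Module F W] [FiniteDimensional F W] (K : Submodule F V)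
    (L : Submodule F W) {k : ℕ} (hk : finrank F K = k) (hK : k ≤ finrank F E)
    (hL : finrank F L + finrank F E = finrank F W) :
    ∃ (g : (Fin k → E) →ₗ[F] V →ₗ[F] W) (s : (Fin k → E) →ₗ[F] E),
      (0 < k → Function.Surjective s) ∧
      (∀ e, K ≤ L.comap (g e) → e = 0) ∧
      ∀ e, e ≠ 0 → s e = 0 → finrank F ↥(K ⊓ L.comap (g e)) + 2 ≤ k := by
  subst hk
  obtain ⟨p, hp⟩ := K.subtype.exists_leftInverse_of_injective K.ker_subtype
  obtain ⟨L', hL'⟩ := L.exists_isCompl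
  have hfin := Submodule.finrank_add_eq_of_isCompl hL'
  let j : E ≃ₗ[F] L' := LinearEquiv.ofFinrankEq E L' (by omega)
  let b := finBasis F K
  obtain ⟨a, ha⟩ := exists_linearIndependent_of_le_finrank hK
  let g : (Fin (finrank F K) → E) →ₗ[F] V →ₗ[F] W :=
    { toFun := fun e => L'.subtype ∘ₗ j.toLinearMap ∘ₗ b.constr F e ∘ₗ p
      map_add' := fun e e' => by ext x; simp
      map_smul' := fun c e => by ext x; simp }
  have hg (e) (x : K) : g e x ∈ L ↔ b.constr F e x = 0 := by
    have hpx : p x = x := LinearMap.congr_fun hp x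
    have hval : g e x = (j (b.constr F e x) : W) := by
      change ((j (b.constr F e (p x))) : W) = _
      rw [hpx]
    rw [hval]
    refine ⟨fun h => ?_, fun h => by simp [h]⟩
    have h0 : ((j (b.constr F e x)) : W) = 0 :=
      Submodule.disjoint_def.mp hL'.disjoint _ h (j (b.constr F e x)).2
    exact j.map_eq_zero_iff.mp (Subtype.ext h0)
  have hker (e) : finrank F ↥(K ⊓ L.comap (g e)) = finrank F (LinearMap.ker (b.constr F e)) := by
    have hmap : K ⊓ L.comap (g e) = (LinearMap.ker (b.constr F e)).map K.subtype := by
      ext x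
      simp only [Submodule.mem_inf, Submodule.mem_comap, Submodule.mem_map, LinearMap.mem_ker,
        Submodule.subtype_apply, Subtype.exists, exists_and_right, exists_eq_right]
      exact ⟨fun ⟨hx, h⟩ => ⟨hx, (hg e ⟨x, hx⟩).mp h⟩, fun ⟨hx, h⟩ => ⟨hx, (hg e ⟨x, hx⟩).mpr h⟩⟩
    rw [hmap, (Submodule.equivMapOfInjective K.subtype K.injective_subtype _).finrank_eq]
  refine ⟨g, ∑ i, LinearMap.mulLeft F (a i) ∘ₗ LinearMap.proj i, fun hpos y => ?_,
    fun e he => ?_, fun e he hs => ?_⟩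
  · refine ⟨Pi.single ⟨0, hpos⟩ ((a ⟨0, hpos⟩)⁻¹ * y), ?_⟩
    have := ha.ne_zero ⟨0, hpos⟩
    simp [Pi.single_apply, mul_inv_cancel_left₀ this]
  · have h0 : b.constr F e = 0 := LinearMap.ext fun x => (hg e x).mp (he x.2)
    exact (LinearEquiv.map_eq_zero_iff (b.constr F)).mp h0
  · have hrel : ∑ i, a i * e i = 0 := by simpa using hs
    have h2 := two_le_finrank_span_of_relation ha he hrel
    have hrank := (b.constr F e).finrank_range_add_finrank_ker
    rw [b.constr_range] at hrank
    rw [hker e]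
    omega

/-- The subspace of `V × W` that projects onto `K`, meets `W` in `L`, and contains the graph of
the restriction of `φ` to `K`. -/
def graphLift {F V W : Type*} [Field F] [AddCommGroup V] [Module F V] [AddCommGroup W]
    [Module F W] (K : Submodule F V) (L : Submodule F W) (φ : V →ₗ[F] W) :
    Submodule F (V × W) :=
  K.comap (LinearMap.fst F V W) ⊓ L.comap (LinearMap.snd F V W - φ ∘ₗ LinearMap.fst F V W)

section GraphLift

variable {F V W : Type*} [Field F] [AddCommGroup V] [Module F V] [AddCommGroup W] [Module F W]

theorem mem_graphLift {K : Submodule F V} {L : Submodule F W} {φ : V →ₗ[F] W} {z : V × W} :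
    z ∈ graphLift K L φ ↔ z.1 ∈ K ∧ z.2 - φ z.1 ∈ L := Iff.rfl

theorem le_of_graphLift_le_graphLift {K K' : Submodule F V} {L L' : Submodule F W}
    {φ φ' : V →ₗ[F] W} (h : graphLift K L φ ≤ graphLift K' L' φ') : K ≤ K' ∧ L ≤ L' := by
  constructor
  · intro x hx
    exact (h (show (x, φ x) ∈ graphLift K L φ from ⟨hx, by simp⟩)).1
  · intro y hy
    have := (h (show ((0 : V), y) ∈ graphLift K L φ from ⟨K.zero_mem, by simpa using hy⟩)).2
    simpa using this

variable [FiniteDimensional F V] [FiniteDimensional F W]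

/-- Rank-nullity for the projection of a subspace of `V × W` to `V`. -/
theorem finrank_map_fst_add_finrank_comap_inr (X : Submodule F (V × W)) :
    Module.finrank F ↥(X.map (LinearMap.fst F V W)) +
      Module.finrank F ↥(X.comap (LinearMap.inr F V W)) = Module.finrank F X := by
  have hmap : (X.comap (LinearMap.inr F V W)).map (LinearMap.inr F V W) =
      (LinearMap.ker ((LinearMap.fst F V W).domRestrict X)).map X.subtype := by
    ext ⟨x, y⟩
    simp only [Submodule.mem_map, Submodule.mem_comap, LinearMap.inr_apply, LinearMap.mem_ker,
      LinearMap.domRestrict_apply, LinearMap.fst_apply, Submodule.subtype_apply, Subtype.exists,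
      exists_and_right, exists_eq_right, Prod.mk.injEq]
    constructor
    · rintro ⟨y', h, rfl, rfl⟩
      exact ⟨h, rfl⟩
    · rintro ⟨h, rfl⟩
      exact ⟨y, h, rfl, rfl⟩
  rw [← ((LinearMap.fst F V W).domRestrict X).finrank_range_add_finrank_ker,
    LinearMap.range_domRestrict,
    (Submodule.equivMapOfInjective (LinearMap.inr F V W) LinearMap.inr_injective _).finrank_eq,
    (Submodule.equivMapOfInjective X.subtype X.injective_subtype _).finrank_eq, hmap]

theorem finrank_graphLift (K : Submodule F V) (L : Submodule F W) (φ : V →ₗ[F] W) :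
    Module.finrank F (graphLift K L φ) = Module.finrank F K + Module.finrank F L := by
  have hfst : (graphLift K L φ).map (LinearMap.fst F V W) = K := by
    ext x
    constructor
    · rintro ⟨z, hz, rfl⟩
      exact hz.1
    · exact fun hx => ⟨(x, φ x), ⟨hx, by simp⟩, rfl⟩
  have hinr : (graphLift K L φ).comap (LinearMap.inr F V W) = L := by
    ext y
    simp [mem_graphLift]
  rw [← finrank_map_fst_add_finrank_comap_inr, hfst, hinr]

theorem finrank_graphLift_inf_le (K K' : Submodule F V) (L L' : Submodule F W)
    (φ φ' : V →ₗ[F] W) :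
    Module.finrank F ↥(graphLift K L φ ⊓ graphLift K' L' φ') ≤
      Module.finrank F ↥(K ⊓ K') + Module.finrank F ↥(L ⊓ L') := by
  rw [← finrank_map_fst_add_finrank_comap_inr]
  refine add_le_add (Submodule.finrank_mono ?_) (Submodule.finrank_mono ?_)
  · rintro _ ⟨z, hz, rfl⟩
    exact ⟨hz.1.1, hz.2.1⟩
  · intro y hy
    simpa [mem_graphLift] using hy

theorem finrank_graphLift_inf_same_le (K : Submodule F V) (L : Submodule F W)
    (φ φ' : V →ₗ[F] W) :
    Module.finrank F ↥(graphLift K L φ ⊓ graphLift K L φ') ≤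
      Module.finrank F ↥(K ⊓ L.comap (φ - φ')) + Module.finrank F L := by
  rw [← finrank_map_fst_add_finrank_comap_inr]
  refine add_le_add (Submodule.finrank_mono ?_) (Submodule.finrank_mono ?_)
  · rintro _ ⟨z, hz, rfl⟩
    refine ⟨hz.1.1, ?_⟩
    have := L.sub_mem hz.2.2 hz.1.2
    simpa using this
  · intro y hy
    have := hy.1.2
    simpa using this

end GraphLift

open Module in
theorem exists_graphLift_code {p : ℕ} [Fact p.Prime] {V W : Type*} [AddCommGroup V]
    [Module (ZMod p) V] [FiniteDimensional (ZMod p) V] [AddCommGroup W] [Module (ZMod p) W]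
    [FiniteDimensional (ZMod p) W] (K : Submodule (ZMod p) V) (L : Submodule (ZMod p) W)
    (hK : 2 ≤ finrank (ZMod p) K)
    (hKL : finrank (ZMod p) K + finrank (ZMod p) L ≤ finrank (ZMod p) W) :
    ∃ C : Finset (Submodule (ZMod p) (V × W)),
      C.card =
        p ^ ((finrank (ZMod p) W - finrank (ZMod p) L) * (finrank (ZMod p) K - 1)) ∧
      (∀ X ∈ C, ∃ φ, X = graphLift K L φ) ∧
      ∀ X ∈ C, ∀ Y ∈ C, X ≠ Y →
        finrank (ZMod p) ↥(X ⊓ Y) + 2 ≤ finrank (ZMod p) K + finrank (ZMod p) L := by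
  classical
  set m := finrank (ZMod p) W - finrank (ZMod p) L with hm
  have hE : finrank (ZMod p) (GaloisField p m) = m := GaloisField.finrank p (by omega)
  obtain ⟨g, s, hs, -, hg⟩ :=
    exists_syndrome (E := GaloisField p m) K L rfl (by omega) (by omega)
  have hfin : Finite (LinearMap.ker s) := Module.finite_of_finite (ZMod p)
  have := Fintype.ofFinite (LinearMap.ker s)
  have hdist (e e' : LinearMap.ker s) (hne : e ≠ e') :
      finrank (ZMod p) ↥(graphLift K L (g e) ⊓ graphLift K L (g e')) + 2 ≤
        finrank (ZMod p) K + finrank (ZMod p) L := by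
    have h1 := finrank_graphLift_inf_same_le K L (g e) (g e')
    have h2 := hg (e - e' : LinearMap.ker s) (by simpa [sub_eq_zero] using hne) (e - e').2
    rw [Submodule.coe_sub, map_sub] at h2
    omega
  have hinj : Function.Injective fun e : LinearMap.ker s => graphLift K L (g e) := by
    intro e e' h
    by_contra hne
    have h1 := hdist e e' hne
    simp only at h
    rw [← h, inf_idem, finrank_graphLift] at h1
    omega
  refine ⟨Finset.univ.image fun e : LinearMap.ker s => graphLift K L (g e), ?_, ?_, ?_⟩
  · rw [Finset.card_image_of_injective _ hinj, Finset.card_univ, ← Nat.card_eq_fintype_card,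
      Module.natCard_eq_pow_finrank (K := ZMod p), Nat.card_zmod]
    congr 1
    have h1 := s.finrank_range_add_finrank_ker
    rw [LinearMap.range_eq_top.mpr (hs (by omega)), finrank_top, Module.finrank_pi_fintype, hE] at h1
    simp only [Finset.sum_const, Finset.card_univ, Fintype.card_fin, smul_eq_mul] at h1
    rw [Nat.mul_sub_one, mul_comm m]
    omega
  · simp only [Finset.mem_image, Finset.mem_univ, true_and]
    rintro _ ⟨e, rfl⟩
    exact ⟨_, rfl⟩
  · simp only [Finset.mem_image, Finset.mem_univ, true_and]
    rintro _ ⟨e, rfl⟩ _ ⟨e', rfl⟩ hne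
    exact hdist e e' fun h => hne (by rw [h])

open Module in
/-- Pairs of subspaces `(K, L)` with `dim K + dim L = n` that are pairwise far apart give a
constant-dimension code in `V × W`: replace each pair by a lifted maximum rank distance code. -/
theorem exists_code_of_pairs {p : ℕ} [Fact p.Prime] {V W : Type*} [AddCommGroup V]
    [Module (ZMod p) V] [FiniteDimensional (ZMod p) V] [AddCommGroup W] [Module (ZMod p) W]
    [FiniteDimensional (ZMod p) W] {n : ℕ} (hn : n ≤ finrank (ZMod p) W)
    (R : Finset (Submodule (ZMod p) V × Submodule (ZMod p) W))
    (hR : ∀ r ∈ R, finrank (ZMod p) r.1 + finrank (ZMod p) r.2 = n)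
    (hR2 : ∀ r ∈ R, 2 ≤ finrank (ZMod p) r.1)
    (hRR : ∀ r ∈ R, ∀ t ∈ R, r ≠ t →
      finrank (ZMod p) ↥(r.1 ⊓ t.1) + finrank (ZMod p) ↥(r.2 ⊓ t.2) + 2 ≤ n) :
    ∃ C : Finset (Submodule (ZMod p) (V × W)),
      C.card = ∑ r ∈ R,
        p ^ ((finrank (ZMod p) W - finrank (ZMod p) r.2) * (finrank (ZMod p) r.1 - 1)) ∧
      (∀ X ∈ C, ∃ r ∈ R, ∃ φ, X = graphLift r.1 r.2 φ) ∧
      (∀ X ∈ C, finrank (ZMod p) X = n) ∧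
      ∀ X ∈ C, ∀ Y ∈ C, X ≠ Y → finrank (ZMod p) ↥(X ⊓ Y) + 2 ≤ n := by
  classical
  have hex (r : R) := exists_graphLift_code r.1.1 r.1.2 (hR2 r r.2)
    ((hR r r.2).trans_le hn)
  choose C hcard hform hdist using hex
  have hdim (r : R) (X) (hX : X ∈ C r) : finrank (ZMod p) X = n := by
    obtain ⟨φ, rfl⟩ := hform r X hX
    rw [finrank_graphLift, hR r r.2]
  have hcross (r t : R) (hrt : r ≠ t) (X) (hX : X ∈ C r) (Y) (hY : Y ∈ C t) :
      finrank (ZMod p) ↥(X ⊓ Y) + 2 ≤ n := by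
    obtain ⟨φ, rfl⟩ := hform r X hX
    obtain ⟨ψ, rfl⟩ := hform t Y hY
    have h1 := finrank_graphLift_inf_le r.1.1 t.1.1 r.1.2 t.1.2 φ ψ
    have h2 := hRR r r.2 t t.2 (fun h => hrt (Subtype.ext h))
    omega
  refine ⟨Finset.univ.biUnion C, ?_, ?_, ?_, ?_⟩
  · rw [Finset.card_biUnion, ← Finset.sum_coe_sort R]
    · exact Finset.sum_congr rfl fun r _ => hcard r
    · intro r _ t _ hrt
      refine Finset.disjoint_left.mpr fun X hX hX' => ?_
      have h1 := hcross r t hrt X hX X hX'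
      rw [inf_idem, hdim r X hX] at h1
      omega
  · intro X hX
    obtain ⟨r, -, hr⟩ := Finset.mem_biUnion.mp hX
    exact ⟨r, r.2, hform r X hr⟩
  · intro X hX
    obtain ⟨r, -, hr⟩ := Finset.mem_biUnion.mp hX
    exact hdim r X hr
  · intro X hX Y hY hXY
    obtain ⟨r, -, hr⟩ := Finset.mem_biUnion.mp hX
    obtain ⟨t, -, ht⟩ := Finset.mem_biUnion.mp hY
    by_cases hrt : r = t
    · subst hrt
      rw [← hR r r.2]
      exact hdist r X hr Y ht hXY
    · exact hcross r t hrt X hr Y ht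

open Module in
theorem card_hyperplanes_le {p : ℕ} [Fact p.Prime] {V : Type*} [AddCommGroup V]
    [Module (ZMod p) V] [FiniteDimensional (ZMod p) V] (U : Submodule (ZMod p) V)
    (S : Finset (Submodule (ZMod p) V))
    (hS : ∀ T ∈ S, T ≤ U ∧ finrank (ZMod p) T + 1 = finrank (ZMod p) U) :
    S.card ≤ p ^ finrank (ZMod p) U := by
  classical
  have hex (T : S) : ∃ f : Dual (ZMod p) U, (LinearMap.ker f).map U.subtype = T := by
    obtain ⟨hTU, hT⟩ := hS T T.2
    have hmap : (T.1.comap U.subtype).map U.subtype = T.1 := by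
      rw [Submodule.map_comap_subtype, inf_eq_right.mpr hTU]
    have hrank : finrank (ZMod p) (T.1.comap U.subtype) = finrank (ZMod p) T.1 :=
      (Submodule.comapSubtypeEquivOfLe hTU).finrank_eq
    have hlt : T.1.comap U.subtype < ⊤ := by
      refine lt_top_iff_ne_top.mpr fun h => ?_
      rw [h, finrank_top] at hrank
      omega
    obtain ⟨f, hf, hle⟩ := Submodule.exists_le_ker_of_lt_top _ hlt
    have hker : LinearMap.ker f ≠ ⊤ := fun h => hf (LinearMap.ker_eq_top.mp h)
    have h1 := Submodule.finrank_lt hker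
    have h2 := Submodule.finrank_mono hle
    refine ⟨f, ?_⟩
    rw [← Submodule.eq_of_le_of_finrank_eq hle (by omega), hmap]
  choose f hf using hex
  have hfin : Finite (Dual (ZMod p) U) := Module.finite_of_finite (ZMod p)
  have hinj : Function.Injective f := fun T T' h => Subtype.ext (by rw [← hf T, h, hf T'])
  have hle := Nat.card_le_card_of_injective f hinj
  rwa [Nat.card_eq_fintype_card, Fintype.card_coe, Module.natCard_eq_pow_finrank (K := ZMod p),
    Nat.card_zmod, Subspace.dual_finrank_eq] at hle


theorem span_singleton_inf_span_singleton_eq_bot {V : Type*} [AddCommGroup V] [Module (ZMod 2) V]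
    {x y : V} (hxy : x ≠ y) :
    Submodule.span (ZMod 2) {x} ⊓ Submodule.span (ZMod 2) {y} = ⊥ := by
  have hzmod : ∀ c : ZMod 2, c = 0 ∨ c = 1 := by decide
  refine (Submodule.eq_bot_iff _).mpr fun z hz => ?_
  obtain ⟨a, rfl⟩ := Submodule.mem_span_singleton.mp hz.1
  obtain ⟨b, hb⟩ := Submodule.mem_span_singleton.mp hz.2
  rcases hzmod a with rfl | rfl
  · rw [zero_smul]
  · rcases hzmod b with rfl | rfl
    · rw [← hb, zero_smul]
    · exact absurd (by simpa using hb.symm) hxy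

theorem exists_points {ι V : Type*} [Finite ι] [AddCommGroup V] [Module (ZMod 2) V]
    [FiniteDimensional (ZMod 2) V] (h : Nat.card ι < 2 ^ Module.finrank (ZMod 2) V) :
    ∃ P : ι → Submodule (ZMod 2) V, (∀ i, Module.finrank (ZMod 2) (P i) = 1) ∧
      ∀ i j, i ≠ j → P i ⊓ P j = ⊥ := by
  classical
  have := Module.finite_of_finite (ZMod 2) (M := V)
  have := Fintype.ofFinite V
  have := Fintype.ofFinite ι
  have hcard : Fintype.card ι ≤ Fintype.card {x : V // x ≠ 0} := by
    have hV := Module.natCard_eq_pow_finrank (K := ZMod 2) (V := V)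
    rw [Nat.card_zmod, Nat.card_eq_fintype_card] at hV
    rw [Nat.card_eq_fintype_card] at h
    rw [Fintype.card_subtype_compl, Fintype.card_subtype_eq]
    omega
  obtain ⟨f⟩ := Function.Embedding.nonempty_of_card_le hcard
  refine ⟨fun i => Submodule.span (ZMod 2) {(f i : V)}, fun i => finrank_span_singleton (f i).2,
    fun i j hij => span_singleton_inf_span_singleton_eq_bot fun h => hij ?_⟩
  exact f.injective (Subtype.ext h)

/-- The vector of the first four binary digits of a natural number. -/
def binaryVec (n : ℕ) : Fin 4 → ZMod 2 := fun k => if n.testBit k then 1 else 0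

/-- Generators of the 35 lines of `PG(3, 2)`, partitioned into seven spreads. -/
def parallelismTable : Matrix (Fin 7) (Fin 5) (ℕ × ℕ) :=
  !![(1, 2), (4, 8), (5, 10), (6, 11), (7, 9);
     (1, 4), (2, 8), (3, 13), (6, 9), (7, 11);
     (1, 6), (2, 9), (3, 12), (4, 10), (5, 8);
     (1, 8), (2, 12), (3, 5), (4, 11), (7, 10);
     (1, 10), (2, 13), (3, 4), (5, 9), (6, 8);
     (1, 12), (2, 4), (3, 9), (5, 11), (7, 8);
     (1, 14), (2, 5), (3, 8), (4, 9), (6, 10)]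

/-- The `s`-th line of the `i`-th spread of the parallelism. -/
def parallelLine (i : Fin 7) (s : Fin 5) : Submodule (ZMod 2) (Fin 4 → ZMod 2) :=
  Submodule.span (ZMod 2)
    {binaryVec (parallelismTable i s).1, binaryVec (parallelismTable i s).2}

theorem finrank_parallelLine (i : Fin 7) (s : Fin 5) :
    Module.finrank (ZMod 2) (parallelLine i s) = 2 := by
  have hlin : LinearIndependent (ZMod 2)
      ![binaryVec (parallelismTable i s).1, binaryVec (parallelismTable i s).2] := by
    rw [LinearIndependent.pair_iff]
    revert i s
    decide +kernel
  have h := finrank_span_eq_card hlin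
  rwa [Matrix.range_cons, Matrix.range_cons, Matrix.range_empty, Set.union_empty,
    Set.singleton_union, Fintype.card_fin] at h

theorem parallelLine_inf_eq_bot (i : Fin 7) {s t : Fin 5} (hst : s ≠ t) :
    parallelLine i s ⊓ parallelLine i t = ⊥ := by
  have key : ∀ (i : Fin 7) (s t : Fin 5), s ≠ t → ∀ a b c d : ZMod 2,
      c • binaryVec (parallelismTable i t).1 + d • binaryVec (parallelismTable i t).2 =
        a • binaryVec (parallelismTable i s).1 + b • binaryVec (parallelismTable i s).2 →
      a • binaryVec (parallelismTable i s).1 + b • binaryVec (parallelismTable i s).2 = 0 := by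
    decide +kernel
  refine (Submodule.eq_bot_iff _).mpr fun z hz => ?_
  obtain ⟨a, b, rfl⟩ := Submodule.mem_span_pair.mp hz.1
  obtain ⟨c, d, h⟩ := Submodule.mem_span_pair.mp hz.2
  exact key i s t hst a b c d h

theorem parallelLine_ne {i j : Fin 7} (hij : i ≠ j) (s t : Fin 5) :
    parallelLine i s ≠ parallelLine j t := by
  have key : ∀ (i j : Fin 7) (s t : Fin 5), i ≠ j →
      ¬ ((∃ a b : ZMod 2, a • binaryVec (parallelismTable j t).1 +
          b • binaryVec (parallelismTable j t).2 = binaryVec (parallelismTable i s).1) ∧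
        ∃ a b : ZMod 2, a • binaryVec (parallelismTable j t).1 +
          b • binaryVec (parallelismTable j t).2 = binaryVec (parallelismTable i s).2) := by
    decide +kernel
  intro h
  have hle : parallelLine i s ≤ parallelLine j t := h.le
  exact key i j s t hij
    ⟨Submodule.mem_span_pair.mp (hle (Submodule.subset_span (by simp))),
      Submodule.mem_span_pair.mp (hle (Submodule.subset_span (by simp)))⟩

theorem finrank_inf_lt_of_ne {F V : Type*} [Field F] [AddCommGroup V] [Module F V]
    [FiniteDimensional F V] {K K' : Submodule F V}
    (h : Module.finrank F K = Module.finrank F K') (hne : K ≠ K') :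
    Module.finrank F ↥(K ⊓ K') < Module.finrank F K := by
  refine Submodule.finrank_lt_finrank_of_lt (lt_of_le_of_ne inf_le_left fun heq => hne ?_)
  exact Submodule.eq_of_le_of_finrank_eq (inf_eq_left.mp heq) h

theorem finrank_parallelLine_inf_le {i j : Fin 7} (hij : i ≠ j) (s t : Fin 5) :
    Module.finrank (ZMod 2) ↥(parallelLine i s ⊓ parallelLine j t) ≤ 1 := by
  have h := finrank_inf_lt_of_ne
    ((finrank_parallelLine i s).trans (finrank_parallelLine j t).symm) (parallelLine_ne hij s t)
  rw [finrank_parallelLine] at h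
  omega

open Module in
/-- Planes of `F₂⁴ × F₂⁴` that meet the second factor in a point, coloured such that planes of the
same colour meet in at most a point. -/
theorem exists_coloured_planes :
    ∃ (T : Finset (Submodule (ZMod 2) ((Fin 4 → ZMod 2) × (Fin 4 → ZMod 2))))
      (c : Submodule (ZMod 2) ((Fin 4 → ZMod 2) × (Fin 4 → ZMod 2)) →
        ZMod 15 × GaloisField 2 3),
      T.card = 33600 ∧
      (∀ t ∈ T, ∃ K Q φ, t = graphLift K Q φ ∧ finrank (ZMod 2) K = 2 ∧
        finrank (ZMod 2) Q = 1) ∧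
      ∀ t ∈ T, ∀ u ∈ T, t ≠ u → c t = c u → finrank (ZMod 2) ↥(t ⊓ u) ≤ 1 := by
  classical
  obtain ⟨P, hP, hPP⟩ := exists_points (ι := ZMod 15) (V := Fin 4 → ZMod 2) (by simp)
  have hE : finrank (ZMod 2) (GaloisField 2 3) = 3 := GaloisField.finrank 2 (by norm_num)
  let Q (i : Fin 7) (j : ZMod 15) : Submodule (ZMod 2) (Fin 4 → ZMod 2) := P ((i : ℕ) + j)
  have hex (i : Fin 7) (s : Fin 5) (j : ZMod 15) :=
    exists_syndrome (E := GaloisField 2 3) (parallelLine i s) (Q i j) (finrank_parallelLine i s)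
      (by omega) (by rw [hP, hE]; simp)
  choose g σ _ hg hgσ using hex
  let τ : Fin 7 × Fin 5 × ZMod 15 × (Fin 2 → GaloisField 2 3) →
      Submodule (ZMod 2) ((Fin 4 → ZMod 2) × (Fin 4 → ZMod 2)) :=
    fun x => graphLift (parallelLine x.1 x.2.1) (Q x.1 x.2.2.1) (g x.1 x.2.1 x.2.2.1 x.2.2.2)
  have hlines (i i' : Fin 7) (s s' : Fin 5) (h : parallelLine i s = parallelLine i' s') :
      i = i' ∧ s = s' := by
    have hi : i = i' := by
      by_contra hne
      exact parallelLine_ne hne s s' h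
    subst hi
    refine ⟨rfl, ?_⟩
    by_contra hne
    have h1 := parallelLine_inf_eq_bot i hne
    have h2 := finrank_parallelLine i s
    rw [← h, inf_idem] at h1
    rw [h1, finrank_bot] at h2
    omega
  have hpoints (k l : ZMod 15) (h : P k = P l) : k = l := by
    by_contra hne
    have h1 := hPP k l hne
    have h2 := hP k
    rw [← h, inf_idem] at h1
    rw [h1, finrank_bot] at h2
    omega
  have hτ : Function.Injective τ := by
    rintro ⟨i, s, j, e⟩ ⟨i', s', j', e'⟩ h
    obtain ⟨h1, h2⟩ := le_of_graphLift_le_graphLift h.le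
    obtain ⟨h3, h4⟩ := le_of_graphLift_le_graphLift h.ge
    obtain ⟨rfl, rfl⟩ := hlines _ _ _ _ (h1.antisymm h3)
    obtain rfl : j = j' := add_left_cancel (hpoints _ _ (h2.antisymm h4))
    have he : e - e' = 0 := by
      apply hg i s j
      intro x hx
      have hx' : (x, g i s j e x) ∈ graphLift (parallelLine i s) (Q i j) (g i s j e') :=
        h.le (show (x, g i s j e x) ∈ graphLift _ _ (g i s j e) from ⟨hx, by simp⟩)
      rw [map_sub]
      exact hx'.2
    rw [sub_eq_zero.mp he]
  have hcol (x y) (hxy : x ≠ y) (hj : x.2.2.1 = y.2.2.1)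
      (hσ : σ x.1 x.2.1 x.2.2.1 x.2.2.2 = σ y.1 y.2.1 y.2.2.1 y.2.2.2) :
      finrank (ZMod 2) ↥(τ x ⊓ τ y) ≤ 1 := by
    obtain ⟨i, s, j, e⟩ := x
    obtain ⟨i', s', j', e'⟩ := y
    simp only at hj hσ
    subst hj
    have hle := finrank_graphLift_inf_le (parallelLine i s) (parallelLine i' s') (Q i j) (Q i' j)
      (g i s j e) (g i' s' j e')
    have hQ : finrank (ZMod 2) ↥(Q i j ⊓ Q i' j) ≤ 1 :=
      (Submodule.finrank_mono inf_le_left).trans (hP _).le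
    by_cases hi : i = i'
    · subst hi
      by_cases hs : s = s'
      · subst hs
        have h1 := finrank_graphLift_inf_same_le (parallelLine i s) (Q i j) (g i s j e)
          (g i s j e')
        have h2 := hgσ i s j (e - e') (fun h => hxy (by rw [sub_eq_zero.mp h]))
          (by rw [map_sub, hσ, sub_self])
        rw [map_sub] at h2
        have h3 := hP (i + j)
        change _ ≤ _ + finrank (ZMod 2) ↥(P (i + j)) at h1
        exact h1.trans (by omega)
      · rw [parallelLine_inf_eq_bot i hs, finrank_bot] at hle
        exact hle.trans (by omega)
    · have h1 := finrank_parallelLine_inf_le hi s s'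
      have h2 : Q i j ⊓ Q i' j = ⊥ := by
        refine hPP _ _ fun h => hi ?_
        have h3 := add_right_cancel h
        have h4 := congrArg ZMod.val h3
        rw [ZMod.val_natCast_of_lt (by omega), ZMod.val_natCast_of_lt (by omega)] at h4
        exact Fin.ext h4
      rw [h2, finrank_bot] at hle
      exact hle.trans (by omega)
  have := Fintype.ofFinite (GaloisField 2 3)
  refine ⟨Finset.univ.image τ, fun t =>
    let x := Function.invFun τ t
    (x.2.2.1, σ x.1 x.2.1 x.2.2.1 x.2.2.2), ?_, ?_, ?_⟩
  · have hcard : Fintype.card (GaloisField 2 3) = 8 := by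
      rw [← Nat.card_eq_fintype_card, GaloisField.card 2 3 (by norm_num)]
      norm_num
    rw [Finset.card_image_of_injective _ hτ, Finset.card_univ]
    simp [hcard, ZMod.card]
  · simp only [Finset.mem_image, Finset.mem_univ, true_and]
    rintro _ ⟨x, rfl⟩
    exact ⟨_, _, _, rfl, finrank_parallelLine _ _, hP _⟩
  · simp only [Finset.mem_image, Finset.mem_univ, true_and]
    rintro _ ⟨x, rfl⟩ _ ⟨y, rfl⟩ hne hc
    simp only [Function.leftInverse_invFun hτ _, Prod.mk.injEq] at hc
    exact hcol x y (fun h => hne (by rw [h])) hc.1 hc.2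

open Module in
/-- A code of 4796 solids in `F₂⁴ × F₂⁴` together with coloured planes contained in none of them. -/
theorem exists_code_and_coloured_planes :
    ∃ (C T : Finset (Submodule (ZMod 2) ((Fin 4 → ZMod 2) × (Fin 4 → ZMod 2))))
      (c : Submodule (ZMod 2) ((Fin 4 → ZMod 2) × (Fin 4 → ZMod 2)) →
        ZMod 15 × GaloisField 2 3),
      C.card = 4796 ∧ 22400 ≤ T.card ∧
      (∀ U ∈ C, finrank (ZMod 2) U = 4) ∧
      (∀ U ∈ C, ∀ U' ∈ C, U ≠ U' → finrank (ZMod 2) ↥(U ⊓ U') ≤ 2) ∧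
      (∀ t ∈ T, finrank (ZMod 2) t = 3) ∧
      (∀ t ∈ T, ∀ U ∈ C, ¬ t ≤ U) ∧
      ∀ t ∈ T, ∀ u ∈ T, t ≠ u → c t = c u → finrank (ZMod 2) ↥(t ⊓ u) ≤ 1 := by
  classical
  have hW : finrank (ZMod 2) (Fin 4 → ZMod 2) = 4 := by simp
  obtain ⟨C₁, hC₁card, hC₁form, hC₁⟩ := exists_graphLift_code
    (⊤ : Submodule (ZMod 2) (Fin 4 → ZMod 2)) (⊥ : Submodule (ZMod 2) (Fin 4 → ZMod 2))
    (by rw [finrank_top, hW]; norm_num) (by rw [finrank_top, finrank_bot, add_zero])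
  rw [finrank_top, finrank_bot, hW] at hC₁card hC₁
  let r : Fin 7 × Fin 5 × Fin 5 →
      Submodule (ZMod 2) (Fin 4 → ZMod 2) × Submodule (ZMod 2) (Fin 4 → ZMod 2) :=
    fun x => (parallelLine x.1 x.2.1, parallelLine x.1 x.2.2)
  have hr (x y) (hxy : x ≠ y) :
      finrank (ZMod 2) ↥((r x).1 ⊓ (r y).1) + finrank (ZMod 2) ↥((r x).2 ⊓ (r y).2) + 2 ≤ 4 := by
    obtain ⟨i, s, t⟩ := x
    obtain ⟨i', s', t'⟩ := y
    change finrank (ZMod 2) ↥(parallelLine i s ⊓ parallelLine i' s') +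
      finrank (ZMod 2) ↥(parallelLine i t ⊓ parallelLine i' t') + 2 ≤ 4
    by_cases hi : i = i'
    · subst hi
      have h1 := Submodule.finrank_mono
        (inf_le_left : parallelLine i s ⊓ parallelLine i s' ≤ parallelLine i s)
      have h2 := Submodule.finrank_mono
        (inf_le_left : parallelLine i t ⊓ parallelLine i t' ≤ parallelLine i t)
      rw [finrank_parallelLine] at h1 h2
      by_cases hs : s = s'
      · have ht : t ≠ t' := fun h => hxy (by rw [hs, h])
        rw [parallelLine_inf_eq_bot i ht, finrank_bot]
        omega
      · rw [parallelLine_inf_eq_bot i hs, finrank_bot]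
        omega
    · have h1 := finrank_parallelLine_inf_le hi s s'
      have h2 := finrank_parallelLine_inf_le hi t t'
      omega
  have hrinj : Function.Injective r := by
    intro x y h
    by_contra hne
    have h1 := hr x y hne
    rw [← h, inf_idem, inf_idem, finrank_parallelLine, finrank_parallelLine] at h1
    omega
  obtain ⟨C₂, hC₂card, hC₂form, hC₂dim, hC₂⟩ := exists_code_of_pairs hW.ge (Finset.univ.image r)
    (by
      simp only [Finset.mem_image, Finset.mem_univ, true_and]
      rintro _ ⟨x, rfl⟩
      rw [finrank_parallelLine, finrank_parallelLine])
    (by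
      simp only [Finset.mem_image, Finset.mem_univ, true_and]
      rintro _ ⟨x, rfl⟩
      rw [finrank_parallelLine])
    (by
      simp only [Finset.mem_image, Finset.mem_univ, true_and]
      rintro _ ⟨x, rfl⟩ _ ⟨y, rfl⟩ hne
      exact hr x y fun h => hne (by rw [h]))
  rw [Finset.sum_image fun x _ y _ h => hrinj h] at hC₂card
  simp only [r, finrank_parallelLine, hW, Finset.sum_const, Finset.card_univ] at hC₂card
  have hC₁dim (U) (hU : U ∈ C₁) : finrank (ZMod 2) U = 4 := by
    obtain ⟨φ, rfl⟩ := hC₁form U hU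
    rw [finrank_graphLift, finrank_top, finrank_bot, hW]
  have hcross (U) (hU : U ∈ C₁) (U') (hU' : U' ∈ C₂) : finrank (ZMod 2) ↥(U ⊓ U') ≤ 2 := by
    obtain ⟨φ, rfl⟩ := hC₁form U hU
    obtain ⟨q, hq, ψ, rfl⟩ := hC₂form U' hU'
    obtain ⟨x, -, rfl⟩ := Finset.mem_image.mp hq
    refine (finrank_graphLift_inf_le _ _ _ _ φ ψ).trans ?_
    rw [top_inf_eq, bot_inf_eq, finrank_bot, finrank_parallelLine]
  obtain ⟨T, c, hTcard, hTform, hTc⟩ := exists_coloured_planes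
  have hTdim (t) (ht : t ∈ T) : finrank (ZMod 2) t = 3 := by
    obtain ⟨K, Q, φ, rfl, hK, hQ⟩ := hTform t ht
    rw [finrank_graphLift, hK, hQ]
  have hTC₁ (t) (ht : t ∈ T) (U) (hU : U ∈ C₁) : ¬ t ≤ U := by
    intro hle
    obtain ⟨K, Q, φ, rfl, hK, hQ⟩ := hTform t ht
    obtain ⟨ψ, rfl⟩ := hC₁form U hU
    have h1 := (le_of_graphLift_le_graphLift hle).2
    rw [le_bot_iff.mp h1, finrank_bot] at hQ
    omega
  have hcovered : (T.filter fun t => ∃ U ∈ C₂, t ≤ U).card ≤ 700 * 16 := by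
    have hsub : (T.filter fun t => ∃ U ∈ C₂, t ≤ U) ⊆
        C₂.biUnion fun U => T.filter fun t => t ≤ U := by
      intro t ht
      obtain ⟨ht, U, hU, hle⟩ := Finset.mem_filter.mp ht
      exact Finset.mem_biUnion.mpr ⟨U, hU, Finset.mem_filter.mpr ⟨ht, hle⟩⟩
    have hC₂700 : C₂.card = 700 := by simpa using hC₂card
    rw [← hC₂700]
    refine (Finset.card_le_card hsub).trans (Finset.card_biUnion_le_card_mul _ _ _ fun U hU => ?_)
    refine (card_hyperplanes_le U _ fun t ht => ?_).trans (by rw [hC₂dim U hU]; norm_num)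
    obtain ⟨ht, hle⟩ := Finset.mem_filter.mp ht
    exact ⟨hle, by rw [hTdim t ht, hC₂dim U hU]⟩
  refine ⟨C₁ ∪ C₂, T.filter fun t => ¬ ∃ U ∈ C₂, t ≤ U, c, ?_, ?_, ?_, ?_, ?_, ?_, ?_⟩
  · rw [Finset.card_union_of_disjoint, hC₁card, hC₂card]
    · simp
    · refine Finset.disjoint_left.mpr fun U hU hU' => ?_
      have h1 := hcross U hU U hU'
      rw [inf_idem, hC₁dim U hU] at h1
      omega
  · have h1 := Finset.card_filter_add_card_filter_not (s := T) fun t => ∃ U ∈ C₂, t ≤ U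
    omega
  · intro U hU
    exact (Finset.mem_union.mp hU).elim (hC₁dim U) (hC₂dim U)
  · intro U hU U' hU' hne
    rcases Finset.mem_union.mp hU with hU | hU <;> rcases Finset.mem_union.mp hU' with hU' | hU'
    · have := hC₁ U hU U' hU' hne
      omega
    · exact hcross U hU U' hU'
    · rw [inf_comm]
      exact hcross U' hU' U hU
    · have := hC₂ U hU U' hU' hne
      omega
  · exact fun t ht => hTdim t (Finset.mem_filter.mp ht).1
  · intro t ht U hU hle
    rcases Finset.mem_union.mp hU with hU | hU
    · exact hTC₁ t (Finset.mem_filter.mp ht).1 U hU hle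
    · exact (Finset.mem_filter.mp ht).2 ⟨U, hU, hle⟩
  · exact fun t ht u hu => hTc t (Finset.mem_filter.mp ht).1 u (Finset.mem_filter.mp hu).1

open Module in
theorem exists_large_code :
    ∃ C : Finset (Submodule (ZMod 2)
        (((Fin 4 → ZMod 2) × (Fin 4 → ZMod 2)) × (Fin 8 → ZMod 2))),
      80587907742 ≤ C.card ∧ (∀ X ∈ C, finrank (ZMod 2) X = 4) ∧
      ∀ X ∈ C, ∀ Y ∈ C, X ≠ Y → finrank (ZMod 2) ↥(X ⊓ Y) + 2 ≤ 4 := by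
  classical
  obtain ⟨C, T, c, hCcard, hTcard, hCdim, hC, hTdim, hTC, hTc⟩ :=
    exists_code_and_coloured_planes
  have hW : finrank (ZMod 2) (Fin 8 → ZMod 2) = 8 := by simp
  obtain ⟨P, hP, hPP⟩ := exists_points (ι := ZMod 15 × GaloisField 2 3) (V := Fin 8 → ZMod 2)
    (by rw [Nat.card_prod, Nat.card_zmod, GaloisField.card 2 3 (by norm_num), hW]; norm_num)
  have hCT (U) (hU : U ∈ C) (t) (ht : t ∈ T) : finrank (ZMod 2) ↥(U ⊓ t) ≤ 2 := by
    have h1 : U ⊓ t < t := lt_of_le_of_ne inf_le_right fun h => hTC t ht U hU (inf_eq_right.mp h)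
    have h2 := Submodule.finrank_lt_finrank_of_lt h1
    rw [hTdim t ht] at h2
    omega
  let f (U : Submodule (ZMod 2) ((Fin 4 → ZMod 2) × (Fin 4 → ZMod 2))) :
      Submodule (ZMod 2) ((Fin 4 → ZMod 2) × (Fin 4 → ZMod 2)) ×
        Submodule (ZMod 2) (Fin 8 → ZMod 2) := (U, ⊥)
  let h (t : Submodule (ZMod 2) ((Fin 4 → ZMod 2) × (Fin 4 → ZMod 2))) :
      Submodule (ZMod 2) ((Fin 4 → ZMod 2) × (Fin 4 → ZMod 2)) ×
        Submodule (ZMod 2) (Fin 8 → ZMod 2) := (t, P (c t))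
  have hTT (t) (ht : t ∈ T) (u) (hu : u ∈ T) (htu : t ≠ u) :
      finrank (ZMod 2) ↥(t ⊓ u) + finrank (ZMod 2) ↥(P (c t) ⊓ P (c u)) + 2 ≤ 4 := by
    by_cases hcol : c t = c u
    · have h1 := hTc t ht u hu htu hcol
      rw [hcol, inf_idem, hP]
      omega
    · have h1 := finrank_inf_lt_of_ne ((hTdim t ht).trans (hTdim u hu).symm) htu
      rw [hTdim t ht] at h1
      rw [hPP _ _ hcol, finrank_bot]
      omega
  obtain ⟨D, hDcard, -, hDdim, hD⟩ := exists_code_of_pairs (n := 4) (by rw [hW]; norm_num)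
    (C.image f ∪ T.image h)
    (by
      simp only [Finset.mem_union, Finset.mem_image]
      rintro _ (⟨U, hU, rfl⟩ | ⟨t, ht, rfl⟩)
      · simp [f, hCdim U hU]
      · simp [h, hTdim t ht, hP])
    (by
      simp only [Finset.mem_union, Finset.mem_image]
      rintro _ (⟨U, hU, rfl⟩ | ⟨t, ht, rfl⟩)
      · simp [f, hCdim U hU]
      · simp [h, hTdim t ht])
    (by
      simp only [Finset.mem_union, Finset.mem_image]
      rintro _ (⟨U, hU, rfl⟩ | ⟨t, ht, rfl⟩) _ (⟨U', hU', rfl⟩ | ⟨u, hu, rfl⟩) hne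
      · have h1 := hC U hU U' hU' fun h => hne (by rw [h])
        change finrank (ZMod 2) ↥(U ⊓ U') +
          finrank (ZMod 2) ↥(⊥ ⊓ ⊥ : Submodule (ZMod 2) (Fin 8 → ZMod 2)) + 2 ≤ 4
        rw [bot_inf_eq, finrank_bot]
        omega
      · have h1 := hCT U hU u hu
        change finrank (ZMod 2) ↥(U ⊓ u) +
          finrank (ZMod 2) ↥(⊥ ⊓ P (c u)) + 2 ≤ 4
        rw [bot_inf_eq, finrank_bot]
        omega
      · have h1 := hCT U' hU' t ht
        rw [inf_comm] at h1
        change finrank (ZMod 2) ↥(t ⊓ U') +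
          finrank (ZMod 2) ↥(P (c t) ⊓ ⊥) + 2 ≤ 4
        rw [inf_bot_eq, finrank_bot]
        omega
      · exact hTT t ht u hu fun heq => hne (by rw [heq]))
  refine ⟨D, ?_, hDdim, hD⟩
  have hdisj : Disjoint (C.image f) (T.image h) := by
    refine Finset.disjoint_left.mpr fun q hq hq' => ?_
    obtain ⟨U, hU, rfl⟩ := Finset.mem_image.mp hq
    obtain ⟨t, ht, heq⟩ := Finset.mem_image.mp hq'
    have h1 := hTdim t ht
    rw [show t = U from congrArg Prod.fst heq, hCdim U hU] at h1
    omega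
  have hsumC : ∑ U ∈ C, 2 ^ ((8 - finrank (ZMod 2) (f U).2) * (finrank (ZMod 2) (f U).1 - 1)) =
      4796 * 2 ^ 24 := by
    rw [Finset.sum_congr rfl fun U hU => by
      rw [show finrank (ZMod 2) (f U).1 = 4 from hCdim U hU,
        show finrank (ZMod 2) (f U).2 = 0 from finrank_bot _ _],
      Finset.sum_const, hCcard, smul_eq_mul]
  have hsumT : ∑ t ∈ T, 2 ^ ((8 - finrank (ZMod 2) (h t).2) * (finrank (ZMod 2) (h t).1 - 1)) =
      T.card * 2 ^ 14 := by
    rw [Finset.sum_congr rfl fun t ht => by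
      rw [show finrank (ZMod 2) (h t).1 = 3 from hTdim t ht,
        show finrank (ZMod 2) (h t).2 = 1 from hP _],
      Finset.sum_const, smul_eq_mul]
  rw [hDcard, hW, Finset.sum_union hdisj,
    Finset.sum_image fun U _ U' _ heq => congrArg Prod.fst heq,
    Finset.sum_image fun t _ u _ heq => congrArg Prod.fst heq, hsumC, hsumT]
  omega

theorem statement16 :
    ∃ S : Set (Submodule (ZMod 2) (Fin 16 → ZMod 2)),
      S.ncard = 80587907742 ∧
      (∀ X ∈ S, Module.finrank (ZMod 2) ↥X = 4) ∧
      (∀ X ∈ S, ∀ Y ∈ S, X ≠ Y → 4 ≤ subspaceDist X Y) := by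
  classical
  obtain ⟨C, hcard, hdim, hdist⟩ := exists_large_code
  obtain ⟨D, hDC, hDcard⟩ := Finset.exists_subset_card_eq hcard
  let e := LinearEquiv.ofFinrankEq (R := ZMod 2)
    (((Fin 4 → ZMod 2) × (Fin 4 → ZMod 2)) × (Fin 8 → ZMod 2)) (Fin 16 → ZMod 2) (by simp)
  have hinj : Function.Injective (Submodule.map e.toLinearMap) :=
    Submodule.map_injective_of_injective e.injective
  refine ⟨Submodule.map e.toLinearMap '' D, ?_, ?_, ?_⟩
  · rw [Set.ncard_image_of_injective _ hinj, Set.ncard_coe_finset, hDcard]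
  · rintro _ ⟨X, hX, rfl⟩
    rw [LinearEquiv.finrank_map_eq, hdim X (hDC hX)]
  · rintro _ ⟨X, hX, rfl⟩ _ ⟨Y, hY, rfl⟩ hne
    have h1 := hdist X (hDC hX) Y (hDC hY) fun h => hne (by rw [h])
    have h2 := Submodule.finrank_sup_add_finrank_inf_eq X Y
    rw [subspaceDist, ← Submodule.map_sup, LinearEquiv.finrank_map_eq,
      LinearEquiv.finrank_map_eq, LinearEquiv.finrank_map_eq]
    rw [hdim X (hDC hX), hdim Y (hDC hY)] at h2 ⊢
    omega
end
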